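/- Let n ≥ 1, let θ be a skew diagram, and let μ be a partition with at most n parts. Then, in ℚ(a_i : i ∈ ℤ)[b_i : i ∈ ℤ][x_1,…,x_n], s_θ(x|b)·s_μ(x|a) = Σ_ν c^ν_{θμ}(a,b)·s_ν(x|a), where the sum is over partitions ν with μ ⊆ ν, at most n parts and |ν| ≤ |θ|+|μ|, and c^ν_{θμ}(a,b) = Σ_{ρ : μ ⊆ ρ ⊆ ν} s_θ(a_ρ|b)·H(μ,ρ)·H'(ρ,ν). -/

import Mathlib

open scoped BigOperators

namespace FactorialLR

/-- The cells of the skew diagram `θo / θi`. -/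
def skewCells (θi θo : YoungDiagram) : Finset (ℕ × ℕ) :=
  θo.cells \ θi.cells

/-- A filling of the cell set `s` with entries in `Fin n` (`0`-based, representing the
`1`-based entries `{1,…,n}`) is semistandard if it weakly increases along rows and strictly
increases down columns. -/
def IsSsyt {n : ℕ} (s : Finset (ℕ × ℕ)) (T : s → Fin n) : Prop :=
  (∀ c c' : s, (c : ℕ × ℕ).1 = (c' : ℕ × ℕ).1 → (c : ℕ × ℕ).2 ≤ (c' : ℕ × ℕ).2 → T c ≤ T c') ∧
  (∀ c c' : s, (c : ℕ × ℕ).1 < (c' : ℕ × ℕ).1 → (c : ℕ × ℕ).2 = (c' : ℕ × ℕ).2 → T c < T c')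

/-- The factorial Schur-type polynomial attached to a (possibly skew) cell set `s`:
`Σ_T ∏_{α ∈ s} (x_{T(α)} − a_{T(α)+c(α)})`, where `T` runs over semistandard fillings of `s`
with entries in `{1,…,n}` (stored `0`-based) and `c(α) = j − i` is the content of `α = (i,j)`.
Taking `a = 0` gives the ordinary Schur polynomial. -/
noncomputable def sgen {A : Type} [CommRing A] (n : ℕ) (s : Finset (ℕ × ℕ))
    (x : Fin n → A) (a : ℤ → A) : A :=
  ∑ᶠ T ∈ {T : s → Fin n | IsSsyt s T},
    ∏ c : s, (x (T c) - a ((T c : ℤ) + 1 + ((c : ℕ × ℕ).2 : ℤ) - ((c : ℕ × ℕ).1 : ℤ)))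

/-- The `n`-tuple `a_ρ = (a_{ρ_1+n}, a_{ρ_2+n-1}, …, a_{ρ_n+1})`; the `i`-th entry
(`0`-based `i`) is `a_{ρ_{i+1}+n-(i+1)+1}`. -/
noncomputable def subA {A : Type} [CommRing A] (n : ℕ) (a : ℤ → A) (ρ : YoungDiagram) :
    Fin n → A :=
  fun i => a ((ρ.rowLen i : ℤ) + (n : ℤ) - (i : ℤ))

/-- `|a_ρ| = a_{ρ_1+n} + ⋯ + a_{ρ_n+1}`. -/
noncomputable def aNorm {A : Type} [CommRing A] (n : ℕ) (a : ℤ → A) (ρ : YoungDiagram) : A :=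
  ∑ i : Fin n, subA n a ρ i

/-- `μ → ν` : `ν` is obtained from `μ` by adding a single cell. -/
def Covers (μ ν : YoungDiagram) : Prop :=
  μ ≤ ν ∧ ν.card = μ.card + 1

/-- Chains `μ = ρ⁽⁰⁾ → ρ⁽¹⁾ → ⋯ → ρ⁽ˡ⁾ = ν` of Young diagrams, encoded as lists. -/
def chainSet (μ ν : YoungDiagram) : Set (List YoungDiagram) :=
  {L | L.Chain' Covers ∧ L.head? = some μ ∧ L.getLast? = some ν}

/-- `H(μ,ρ)`: the sum over all chains `μ = ρ⁽⁰⁾ → ⋯ → ρ⁽ʳ⁾ = ρ` of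
`∏_{i=0}^{r-1} 1/(|a_ρ| − |a_{ρ⁽ⁱ⁾}|)`; in particular `H(μ,μ) = 1`. -/
noncomputable def H {K : Type} [Field K] (n : ℕ) (a : ℤ → K) (μ ρ : YoungDiagram) : K :=
  ∑ᶠ L ∈ chainSet μ ρ,
    (L.dropLast.map fun σ => (aNorm n a ρ - aNorm n a σ)⁻¹).prod

/-- `H'(ρ,ν)`: the sum over all chains `ρ = ρ⁽ʳ⁾ → ⋯ → ρ⁽ˡ⁾ = ν` of
`∏_{i=r+1}^{l} 1/(|a_ρ| − |a_{ρ⁽ⁱ⁾}|)`; in particular `H'(ρ,ρ) = 1`. -/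
noncomputable def H' {K : Type} [Field K] (n : ℕ) (a : ℤ → K) (ρ ν : YoungDiagram) : K :=
  ∑ᶠ L ∈ chainSet ρ ν,
    (L.tail.map fun σ => (aNorm n a ρ - aNorm n a σ)⁻¹).prod

/-- The field `ℚ(a_i : i ∈ ℤ)` of rational functions in the variables `a_i`, `i ∈ ℤ`. -/
noncomputable abbrev Kfield : Type := FractionRing (MvPolynomial ℤ ℚ)

/-- The variables `a_i`, `i ∈ ℤ`, as elements of `Kfield`. -/
noncomputable def aK : ℤ → Kfield :=
  fun k => algebraMap (MvPolynomial ℤ ℚ) Kfield (MvPolynomial.X k)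

/-- rows shifted up by one -/
def shiftUp {M : ℕ} (p : Fin M → ℕ) : Fin M → ℕ :=
  fun i => if h : i.val + 1 < M then p ⟨i.val + 1, h⟩ else 0

def rowW {A : Type} [CommRing A] {M : ℕ} (x : A) (b : ℤ → A) (k : ℤ) (p q : Fin M → ℕ) : A :=
  ∏ i : Fin M, ∏ j ∈ Finset.Ico (q i) (p i), (x - b (k + (j : ℤ) - (i.val : ℤ)))

def rowS {A : Type} [CommRing A] {M : ℕ} (x : ℕ → A) (b : ℤ → A) (q : Fin M → ℕ) :
    ℕ → (Fin M → ℕ) → A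
  | 0, p => if p = q then 1 else 0
  | (n + 1), p => ∑ κ ∈ Finset.Icc (shiftUp p) p,
      rowW (x n) b ((n : ℤ) + 1) p κ * rowS x b q n κ

def twoH {A : Type} [CommRing A] (x y : A) (c : ℕ → A) (l m : ℕ) : A :=
  ∑ κ ∈ Finset.Icc l (l + m), (∏ j ∈ Finset.Ico κ (l + m), (y - c (j + 1))) *
    ∏ j ∈ Finset.Ico l κ, (x - c j)

lemma twoH_succ {A : Type} [CommRing A] (x y : A) (c : ℕ → A) (l m : ℕ) :
    twoH x y c l (m + 1) = (y - c (l + m + 1)) * twoH x y c l m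
      + ∏ j ∈ Finset.Ico l (l + m + 1), (x - c j) := by
  unfold twoH
  rw [← add_assoc, ← Finset.insert_Icc_right_eq_Icc_add_one (by omega), Finset.sum_insert (by simp)]
  rw [add_comm, Finset.mul_sum]
  congr 1
  · apply Finset.sum_congr rfl
    intro κ hκ
    rw [Finset.mem_Icc] at hκ
    rw [Finset.prod_Ico_succ_top (by omega)]
    ring
  · simp

lemma twoH_main {A : Type} [CommRing A] (x y : A) (c : ℕ → A) (l m : ℕ) :
    twoH x y c l m = twoH y x c l m ∧
    (x - y) * twoH x y c l m = ∏ j ∈ Finset.Ico l (l + m + 1), (x - c j) -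
      ∏ j ∈ Finset.Ico l (l + m + 1), (y - c j) := by
  induction m with
  | zero => simp [twoH]
  | succ m ih =>
    obtain ⟨h1, h2⟩ := ih
    have e : twoH x y c l (m + 1) = twoH y x c l (m + 1) := by
      rw [twoH_succ, twoH_succ, ← h1]
      linear_combination -h2
    refine ⟨e, ?_⟩
    rw [twoH_succ, ← add_assoc, Finset.prod_Ico_succ_top (b := l + m + 1) (by omega),
      Finset.prod_Ico_succ_top (b := l + m + 1) (by omega)]
    linear_combination (y - c (l + m + 1)) * h2

lemma row_factor {A : Type} [CommRing A] (x y : A) (c : ℕ → A) (t l u p : ℕ)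
    (h1 : t ≤ l) (h2 : l ≤ u) (h3 : u ≤ p) :
    ∑ κ ∈ Finset.Icc l u, (∏ j ∈ Finset.Ico κ p, (y - c (j + 1))) *
      ∏ j ∈ Finset.Ico t κ, (x - c j) =
    (∏ j ∈ Finset.Ico u p, (y - c (j + 1))) * (∏ j ∈ Finset.Ico t l, (x - c j)) *
      twoH x y c l (u - l) := by
  unfold twoH
  rw [Nat.add_sub_cancel' h2, Finset.mul_sum]
  apply Finset.sum_congr rfl
  intro κ hκ
  rw [Finset.mem_Icc] at hκ
  rw [← Finset.prod_Ico_consecutive _ hκ.2 h3, ← Finset.prod_Ico_consecutive _ h1 hκ.1]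
  ring

/-- upper bounds for the intermediate row lengths -/
def upB {M : ℕ} (p t : Fin M → ℕ) : Fin M → ℕ :=
  fun i => if h : 0 < i.val then min (p i) (t ⟨i.val - 1, by omega⟩) else p i

lemma mem_two {M : ℕ} (p t κ : Fin M → ℕ) :
    (κ ∈ Finset.Icc (shiftUp p) p ∧ t ∈ Finset.Icc (shiftUp κ) κ) ↔
      κ ∈ Finset.Icc (shiftUp p ⊔ t) (upB p t) := by
  simp only [Finset.mem_Icc, Pi.le_def, upB, shiftUp, Pi.sup_apply]
  constructor
  · rintro ⟨⟨h1, h2⟩, h3, h4⟩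
    refine ⟨fun i => sup_le (h1 i) (h4 i), fun i => ?_⟩
    split_ifs with h
    · refine le_min (h2 i) ?_
      have := h3 ⟨i.val - 1, by omega⟩
      have e : i.val - 1 + 1 = i.val := by omega
      simp only [e, i.isLt, dite_true] at this
      exact this
    · exact h2 i
  · rintro ⟨h1, h2⟩
    refine ⟨⟨fun i => le_trans le_sup_left (h1 i), fun i => ?_⟩, fun i => ?_,
      fun i => le_trans le_sup_right (h1 i)⟩
    · have := h2 i
      split_ifs at this with h
      · exact le_trans this (min_le_left _ _)
      · exact this
    · split_ifs with h
      · have := h2 ⟨i.val + 1, h⟩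
        simp only [Nat.zero_lt_succ, dite_true, Nat.add_sub_cancel] at this
        exact le_trans this (min_le_right _ _)
      · exact Nat.zero_le _

lemma edge_prod {A : Type} [CommRing A] {M : ℕ} (y : A) (b : ℤ → A) (k : ℤ) (p t : Fin M → ℕ) :
    ∏ i : Fin M, ∏ j ∈ Finset.Ico (upB p t i) (p i), (y - b (k + ((j + 1 : ℕ) : ℤ) - (i.val : ℤ))) =
    ∏ i : Fin M, ∏ j ∈ Finset.Ico (t i) ((shiftUp p ⊔ t) i), (y - b (k + (j : ℤ) - (i.val : ℤ))) := by
  cases M with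
  | zero => simp
  | succ m =>
    rw [Fin.prod_univ_succ, Fin.prod_univ_castSucc]
    have e1 : upB p t 0 = p 0 := by simp [upB]
    have e2 : (shiftUp p ⊔ t) (Fin.last m) = t (Fin.last m) := by simp [shiftUp]
    rw [e1, e2]
    simp only [Finset.Ico_self, Finset.prod_empty, one_mul, mul_one]
    apply Finset.prod_congr rfl
    intro i _
    have e3 : upB p t i.succ = min (p i.succ) (t i.castSucc) := by
      simp only [upB, Fin.val_succ, Nat.zero_lt_succ, dite_true, Nat.add_sub_cancel]; rfl
    have e4 : (shiftUp p ⊔ t) i.castSucc = max (p i.succ) (t i.castSucc) := by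
      simp [shiftUp]; rfl
    rw [e3, e4]
    rcases le_total (p i.succ) (t i.castSucc) with h | h
    · simp [h]
    · rw [min_eq_right h, max_eq_left h]
      apply Finset.prod_congr rfl
      intro j _
      congr 2
      simp only [Fin.val_succ, Fin.val_castSucc]; push_cast; ring

lemma two_sym_fixed {A : Type} [CommRing A] {M : ℕ} (x y : A) (b : ℤ → A) (k : ℤ)
    (p t : Fin M → ℕ) :
    ∑ κ ∈ Finset.Icc (shiftUp p ⊔ t) (upB p t), rowW y b (k + 1) p κ * rowW x b k κ t =
    ∑ κ ∈ Finset.Icc (shiftUp p ⊔ t) (upB p t), rowW x b (k + 1) p κ * rowW y b k κ t := by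
  by_cases hle : shiftUp p ⊔ t ≤ upB p t
  swap
  · rw [Finset.Icc_eq_empty hle]; simp
  have key : ∀ x y : A, ∑ κ ∈ Finset.Icc (shiftUp p ⊔ t) (upB p t),
      rowW y b (k + 1) p κ * rowW x b k κ t =
      (∏ i : Fin M, ∏ j ∈ Finset.Ico (t i) ((shiftUp p ⊔ t) i), (y - b (k + (j : ℤ) - (i.val : ℤ)))) *
      (∏ i : Fin M, ∏ j ∈ Finset.Ico (t i) ((shiftUp p ⊔ t) i), (x - b (k + (j : ℤ) - (i.val : ℤ)))) *
      ∏ i : Fin M, twoH x y (fun j => b (k + (j : ℤ) - (i.val : ℤ))) ((shiftUp p ⊔ t) i)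
        (upB p t i - (shiftUp p ⊔ t) i) := by
    intro x y
    rw [← edge_prod, ← Finset.prod_mul_distrib, ← Finset.prod_mul_distrib]
    have hp : ∀ i, upB p t i ≤ p i := by
      intro i; unfold upB; split_ifs; exacts [min_le_left _ _, le_rfl]
    have := fun i : Fin M => row_factor x y (fun j => b (k + (j : ℤ) - (i.val : ℤ))) (t i)
      ((shiftUp p ⊔ t) i) (upB p t i) (p i) le_sup_right (hle i) (hp i)
    rw [← Finset.prod_congr rfl (fun i _ => this i), Finset.prod_univ_sum]
    apply Finset.sum_congr rfl
    intro κ _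
    rw [rowW, rowW, ← Finset.prod_mul_distrib]
    apply Finset.prod_congr rfl
    intro i _
    congr 1
    apply Finset.prod_congr rfl
    intro j _
    congr 2
    push_cast; ring
  rw [key, key]
  rw [Finset.prod_congr rfl (fun i _ => (twoH_main x y _ _ _).1)]
  ring

lemma two_sym {A : Type} [CommRing A] {M : ℕ} (x y : A) (b : ℤ → A) (k : ℤ)
    (F : (Fin M → ℕ) → A) (p : Fin M → ℕ) :
    ∑ κ ∈ Finset.Icc (shiftUp p) p, rowW y b (k + 1) p κ *
        ∑ t ∈ Finset.Icc (shiftUp κ) κ, rowW x b k κ t * F t =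
    ∑ κ ∈ Finset.Icc (shiftUp p) p, rowW x b (k + 1) p κ *
        ∑ t ∈ Finset.Icc (shiftUp κ) κ, rowW y b k κ t * F t := by
  have key : ∀ x y : A, ∑ κ ∈ Finset.Icc (shiftUp p) p, rowW y b (k + 1) p κ *
        ∑ t ∈ Finset.Icc (shiftUp κ) κ, rowW x b k κ t * F t =
      ∑ t ∈ Finset.Icc 0 p, (∑ κ ∈ Finset.Icc (shiftUp p ⊔ t) (upB p t),
        rowW y b (k + 1) p κ * rowW x b k κ t) * F t := by
    intro x y
    simp_rw [Finset.mul_sum, Finset.sum_mul]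
    rw [Finset.sum_comm' (t' := Finset.Icc 0 p)
      (s' := fun t => Finset.Icc (shiftUp p ⊔ t) (upB p t))]
    · apply Finset.sum_congr rfl; intro t _
      apply Finset.sum_congr rfl; intro κ _
      ring
    · intro κ t
      rw [mem_two]
      constructor
      · intro h
        refine ⟨h, ?_⟩
        rw [← mem_two] at h
        simp only [Finset.mem_Icc] at h ⊢
        exact ⟨fun i => Nat.zero_le _, h.2.2.trans h.1.2⟩
      · exact fun h => h.1
  rw [key, key]
  apply Finset.sum_congr rfl
  intro t _
  rw [two_sym_fixed]

lemma rowS_congr {A : Type} [CommRing A] {M : ℕ} (x x' : ℕ → A) (b : ℤ → A) (q : Fin M → ℕ)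
    (n : ℕ) (h : ∀ i < n, x i = x' i) (p : Fin M → ℕ) : rowS x b q n p = rowS x' b q n p := by
  induction n generalizing p with
  | zero => rfl
  | succ n ih =>
    simp only [rowS]
    rw [h n (by omega)]
    apply Finset.sum_congr rfl; intro κ _
    rw [ih (fun i hi => h i (by omega))]

lemma rowS_swap {A : Type} [CommRing A] {M : ℕ} (x : ℕ → A) (b : ℤ → A) (q : Fin M → ℕ)
    (k n : ℕ) (h : k + 1 < n) (p : Fin M → ℕ) :
    rowS (fun i => x (Equiv.swap k (k + 1) i)) b q n p = rowS x b q n p := by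
  induction n generalizing p with
  | zero => omega
  | succ n ih =>
    by_cases hk : k + 1 < n
    · simp only [rowS]
      rw [Equiv.swap_apply_of_ne_of_ne (by omega) (by omega)]
      apply Finset.sum_congr rfl; intro κ _
      rw [ih hk]
    · obtain rfl : n = k + 1 := by omega
      simp only [rowS, Equiv.swap_apply_left, Equiv.swap_apply_right]
      have : ∀ t, rowS (fun i => x (Equiv.swap k (k + 1) i)) b q k t = rowS x b q k t := by
        intro t
        apply rowS_congr
        intro i hi
        rw [Equiv.swap_apply_of_ne_of_ne (by omega) (by omega)]
      simp_rw [this]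
      push_cast
      exact two_sym _ _ _ _ _ _

def extF {A : Type} [CommRing A] {n : ℕ} (x : Fin n → A) : ℕ → A :=
  fun i => if h : i < n then x ⟨i, h⟩ else 0

lemma rowS_perm {A : Type} [CommRing A] {M n : ℕ} (x : Fin n → A) (b : ℤ → A) (q : Fin M → ℕ)
    (p : Fin M → ℕ) (σ : Equiv.Perm (Fin n)) :
    rowS (extF (x ∘ σ)) b q n p = rowS (extF x) b q n p := by
  cases n with
  | zero => rfl
  | succ m =>
    have hσ : σ ∈ Submonoid.closure (Set.range fun i : Fin m => Equiv.swap i.castSucc i.succ) := by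
      rw [Equiv.Perm.mclosure_swap_castSucc_succ]; trivial
    induction hσ using Submonoid.closure_induction generalizing x with
    | mem τ h =>
      obtain ⟨i, rfl⟩ := h
      rw [← rowS_swap (extF x) b q i.val (m + 1) (by omega)]
      apply rowS_congr
      intro j hj
      by_cases h1 : j = i.val
      · subst h1
        have : (⟨i.val, hj⟩ : Fin (m+1)) = i.castSucc := rfl
        simp [extF, this]; rfl
      · by_cases h2 : j = i.val + 1
        · subst h2
          have : (⟨i.val + 1, hj⟩ : Fin (m+1)) = i.succ := rfl
          simp [extF, this]; rfl
        · rw [Equiv.swap_apply_of_ne_of_ne h1 h2]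
          simp only [extF, hj, dite_true, Function.comp]
          rw [Equiv.swap_apply_of_ne_of_ne]
          · intro h; apply h1; simpa using congrArg Fin.val h
          · intro h; apply h2; simpa using congrArg Fin.val h
    | one => rfl
    | mul σ τ _ _ h1 h2 =>
      have : x ∘ (σ * τ : Equiv.Perm _) = (x ∘ σ) ∘ τ := rfl
      rw [this, h2, h1]

lemma rowS_vanish {A : Type} [CommRing A] {M : ℕ} (x : ℕ → A) (a : ℤ → A)
    (n : ℕ) (ρ : ℕ → ℕ) (hρ : Antitone ρ) 
    (hx : ∀ i < n, x i = a ((ρ (n - 1 - i) : ℤ) + i + 1)) (p : Fin M → ℕ)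
    (h : rowS x a 0 n p ≠ 0) (i : Fin M) : p i ≤ if i.val < n then ρ i.val else 0 := by
  induction n generalizing ρ p i with
  | zero =>
    simp only [rowS] at h
    split_ifs at h with h0
    · simp [h0]
    · simp at h
  | succ n ih =>
    simp only [rowS] at h
    obtain ⟨κ, hκ, hne⟩ := Finset.exists_ne_zero_of_sum_ne_zero h
    have hS : rowS x a 0 n κ ≠ 0 := right_ne_zero_of_mul hne
    have hW : rowW (x n) a ((n : ℤ) + 1) p κ ≠ 0 := left_ne_zero_of_mul hne
    have IH := ih (fun i => ρ (i + 1)) (fun i j hij => hρ (by omega)) (by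
      intro i hi
      rw [hx i (by omega)]
      have e : n + 1 - 1 - i = n - 1 - i + 1 := by omega
      rw [e]) κ hS
    rw [Finset.mem_Icc] at hκ
    obtain ⟨i, hi⟩ := i
    cases i with
    | zero =>
      simp only [Nat.zero_lt_succ, if_true]
      by_contra hlt
      push Not at hlt
      apply hW
      apply Finset.prod_eq_zero (Finset.mem_univ (⟨0, hi⟩ : Fin M))
      have h0 := IH ⟨0, hi⟩
      have h1 : ρ (0 + 1) ≤ ρ 0 := hρ (by omega)
      apply Finset.prod_eq_zero (i := ρ 0)
      · rw [Finset.mem_Ico]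
        refine ⟨?_, hlt⟩
        split_ifs at h0 <;> simp at h0 h1 <;> omega
      · rw [hx n (by omega), sub_eq_zero]
        congr 1
        simp; ring
    | succ i =>
      have h1 := hκ.1 ⟨i, by omega⟩
      have h2 := IH ⟨i, by omega⟩
      simp only [shiftUp, hi, dite_true] at h1
      simp only [Nat.add_lt_add_iff_right] at *
      exact h1.trans h2

lemma rowS_eq_zero_of_not_antitone {A : Type} [CommRing A] {M : ℕ} (x : ℕ → A) (a : ℤ → A)
    (n : ℕ) (p : Fin M → ℕ) (h : rowS x a 0 n p ≠ 0) : ∀ i, shiftUp p i ≤ p i := by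
  cases n with
  | zero =>
    simp only [rowS] at h
    split_ifs at h with h0
    · subst h0; intro i; simp [shiftUp]
    · simp at h
  | succ n =>
    simp only [rowS] at h
    obtain ⟨κ, hκ, hne⟩ := Finset.exists_ne_zero_of_sum_ne_zero h
    rw [Finset.mem_Icc] at hκ
    exact hκ.1.trans hκ.2

lemma rowS_rows {A : Type} [CommRing A] {M : ℕ} (x : ℕ → A) (a : ℤ → A)
    (n : ℕ) (p : Fin M → ℕ) (h : rowS x a 0 n p ≠ 0) (i : Fin M) (hi : n ≤ i.val) : p i = 0 := by
  induction n generalizing p i with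
  | zero =>
    simp only [rowS] at h
    split_ifs at h with h0
    · subst h0; rfl
    · simp at h
  | succ n ih =>
    simp only [rowS] at h
    obtain ⟨κ, hκ, hne⟩ := Finset.exists_ne_zero_of_sum_ne_zero h
    rw [Finset.mem_Icc] at hκ
    have hS : rowS x a 0 n κ ≠ 0 := right_ne_zero_of_mul hne
    obtain ⟨i, hi'⟩ := i
    cases i with
    | zero => simp at hi
    | succ i =>
      have h1 := hκ.1 ⟨i, by omega⟩
      simp only [shiftUp, hi', dite_true] at h1
      rw [ih κ hS ⟨i, by omega⟩ (by simpa using hi)] at h1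
      omega

open Classical in
noncomputable def rowU {A : Type} [CommRing A] {M : ℕ} (x : A) (b : ℤ → A) (k : ℤ) (p q : Fin M → ℕ) : A :=
  if shiftUp p ≤ q ∧ q ≤ p then rowW x b k p q else 0

def inc {M : ℕ} (p : Fin M → ℕ) (i : Fin M) : Fin M → ℕ := Function.update p i (p i + 1)
def dcr {M : ℕ} (p : Fin M → ℕ) (i : Fin M) : Fin M → ℕ := Function.update p i (p i - 1)

lemma inc_same {M : ℕ} (p : Fin M → ℕ) (i : Fin M) : inc p i i = p i + 1 := by simp [inc]
lemma dcr_same {M : ℕ} (p : Fin M → ℕ) (i : Fin M) : dcr p i i = p i - 1 := by simp [dcr]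
lemma inc_ne {M : ℕ} (p : Fin M → ℕ) {i j : Fin M} (h : j ≠ i) : inc p i j = p j := by
  simp [inc, h]
lemma dcr_ne {M : ℕ} (p : Fin M → ℕ) {i j : Fin M} (h : j ≠ i) : dcr p i j = p j := by
  simp [dcr, h]

def rowN {A : Type} [CommRing A] {M : ℕ} (a : ℤ → A) (n : ℕ) (p : Fin M → ℕ) : A :=
  ∑ i : Fin M, if i.val < n then a ((p i : ℤ) + n - i.val) else 0

lemma strip_iff {m : ℕ} (p q : Fin (m + 1) → ℕ) : (shiftUp p ≤ q ∧ q ≤ p) ↔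
    (∀ i : Fin m, p i.succ ≤ q i.castSucc) ∧ ∀ i, q i ≤ p i := by
  refine and_congr ?_ Iff.rfl
  constructor
  · intro h i
    have := h i.castSucc
    simp [shiftUp] at this
    exact this
  · intro h i
    induction i using Fin.lastCases with
    | last => simp [shiftUp]
    | cast i =>
      have := h i
      simp [shiftUp]
      exact this

lemma rowW_dcr {A : Type} [CommRing A] {M : ℕ} (x : A) (b : ℤ → A) (k : ℤ) (p q : Fin M → ℕ)
    (i : Fin M) (h : 0 < q i) (h' : q i ≤ p i) :
    rowW x b k p (dcr q i) = rowW x b k p q * (x - b (k + q i - 1 - i.val)) := by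
  unfold rowW
  rw [← Finset.mul_prod_erase _ _ (Finset.mem_univ i), ← Finset.mul_prod_erase Finset.univ _ (Finset.mem_univ i),
    dcr_same]
  rw [Finset.prod_eq_prod_Ico_succ_bot (a := q i - 1) (by omega)]
  rw [Finset.prod_congr (g := fun j => ∏ l ∈ Finset.Ico (q j) (p j), (x - b (k + (l : ℤ) - (j.val : ℤ)))) rfl]
  · have e : q i - 1 + 1 = q i := by omega
    rw [e]
    have : k + ((q i - 1 : ℕ) : ℤ) - i.val = k + q i - 1 - i.val := by
      push_cast [Nat.cast_sub (show 1 ≤ q i from h)]; ring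
    rw [this]; ring
  · intro j hj
    rw [dcr_ne _ (Finset.ne_of_mem_erase hj)]

lemma rowW_inc {A : Type} [CommRing A] {M : ℕ} (x : A) (b : ℤ → A) (k : ℤ) (p q : Fin M → ℕ)
    (i : Fin M) (h' : q i ≤ p i) :
    rowW x b k (inc p i) q = rowW x b k p q * (x - b (k + p i - i.val)) := by
  unfold rowW
  rw [← Finset.mul_prod_erase _ _ (Finset.mem_univ i), ← Finset.mul_prod_erase Finset.univ _ (Finset.mem_univ i),
    inc_same]
  rw [Finset.prod_Ico_succ_top (by omega)]
  rw [Finset.prod_congr (g := fun j => ∏ l ∈ Finset.Ico (q j) (p j), (x - b (k + (l : ℤ) - (j.val : ℤ)))) rfl]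
  · ring
  · intro j hj
    rw [inc_ne _ (Finset.ne_of_mem_erase hj)]

lemma rowW_dcr_inc {A : Type} [CommRing A] {M : ℕ} (x : A) (b : ℤ → A) (k : ℤ) (p q : Fin M → ℕ)
    (i : Fin M) (h' : q i = p i + 1) :
    rowW x b k p (dcr q i) = rowW x b k (inc p i) q := by
  unfold rowW
  apply Finset.prod_congr rfl
  intro j _
  by_cases h : j = i
  · subst h; rw [dcr_same, inc_same, h']; simp
  · rw [dcr_ne _ h, inc_ne _ h]

lemma pieri_good {A : Type} [CommRing A] {m : ℕ} (x : A) (a : ℤ → A) (n : ℕ) (hn : n < m + 1)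
    (p q : Fin (m + 1) → ℕ) (hq : ∀ i : Fin (m + 1), n ≤ i.val → q i = 0)
    (hg : shiftUp p ≤ q ∧ q ≤ p) :
    ∑ i, (if 0 < q i then rowU x a ((n : ℤ) + 1) p (dcr q i) else 0) +
      (x + rowN a n q - rowN a (n + 1) p) * rowU x a ((n : ℤ) + 1) p q =
    ∑ i, rowU x a ((n : ℤ) + 1) (inc p i) q := by
  have hg' := (strip_iff p q).1 hg
  obtain ⟨g1, g2⟩ := hg'
  set w := rowW x a ((n : ℤ) + 1) p q with hw
  have hU : rowU x a ((n : ℤ) + 1) p q = w := by rw [rowU, if_pos hg]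
  have hlast : q (Fin.last m) = 0 := hq _ (by simp; omega)
  have hA : ∀ i : Fin m, (if 0 < q i.castSucc then rowU x a ((n : ℤ) + 1) p (dcr q i.castSucc) else 0)
      = if p i.succ < q i.castSucc then w * (x - a ((n : ℤ) + q i.castSucc - i.val)) else 0 := by
    intro i
    by_cases h : p i.succ < q i.castSucc
    · rw [if_pos h, if_pos (by omega), rowU, if_pos, rowW_dcr _ _ _ _ _ _ (by omega) (g2 _)]
      · rw [hw]; congr 3; simp; ring
      · rw [strip_iff]
        constructor
        · intro j
          by_cases hj : j = i
          · subst hj; rw [dcr_same]; omega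
          · rw [dcr_ne _ (by simpa using hj)]; exact g1 j
        · intro j
          by_cases hj : j = i.castSucc
          · subst hj; rw [dcr_same]; exact (Nat.sub_le _ _).trans (g2 _)
          · rw [dcr_ne _ hj]; exact g2 j
    · rw [if_neg h]
      split_ifs with h0
      · rw [rowU, if_neg]
        rw [strip_iff]
        intro hh
        have := hh.1 i
        rw [dcr_same] at this
        omega
      · rfl
  have hB : ∀ i : Fin m, rowU x a ((n : ℤ) + 1) (inc p i.succ) q =
      if p i.succ < q i.castSucc then w * (x - a ((n : ℤ) + p i.succ - i.val)) else 0 := by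
    intro i
    split_ifs with h
    · rw [rowU, if_pos, rowW_inc _ _ _ _ _ _ (g2 _)]
      · rw [hw]; congr 3; simp only [Fin.val_succ]; push_cast; ring
      · rw [strip_iff]
        constructor
        · intro j
          by_cases hj : j = i
          · subst hj; rw [inc_same]; omega
          · rw [inc_ne _ (by simpa using hj)]; exact g1 j
        · intro j
          by_cases hj : j = i.succ
          · subst hj; rw [inc_same]; exact (g2 _).trans (Nat.le_succ _)
          · rw [inc_ne _ hj]; exact g2 j
    · rw [rowU, if_neg]
      rw [strip_iff]
      intro hh
      have := hh.1 i
      rw [inc_same] at this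
      omega
  have hB0 : rowU x a ((n : ℤ) + 1) (inc p 0) q = w * (x - a ((n : ℤ) + 1 + p 0)) := by
    rw [rowU, if_pos, rowW_inc _ _ _ _ _ _ (g2 _)]
    · rw [hw]; simp
    · rw [strip_iff]
      constructor
      · intro j
        rw [inc_ne _ (Fin.succ_ne_zero j)]; exact g1 j
      · intro j
        by_cases hj : j = 0
        · subst hj; rw [inc_same]; exact (g2 _).trans (Nat.le_succ _)
        · rw [inc_ne _ hj]; exact g2 j
  rw [Fin.sum_univ_castSucc, hlast, Fin.sum_univ_succ (f := fun i => rowU x a ((n : ℤ) + 1) (inc p i) q),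
    hB0, hU]
  simp_rw [hA, hB]
  have hN1 : rowN a n q = ∑ i : Fin m, if i.val < n then a ((n : ℤ) + q i.castSucc - i.val) else 0 := by
    unfold rowN
    rw [Fin.sum_univ_castSucc]
    simp only [Fin.val_last, Fin.val_castSucc]
    rw [if_neg (by omega), add_zero]
    apply Finset.sum_congr rfl; intro i _
    congr 3; ring
  have hN2 : rowN a (n + 1) p = a ((n : ℤ) + 1 + p 0) +
      ∑ i : Fin m, if i.val < n then a ((n : ℤ) + p i.succ - i.val) else 0 := by
    unfold rowN
    rw [Fin.sum_univ_succ]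
    congr 1
    · rw [if_pos (by simp)]; congr 1; simp; ring
    apply Finset.sum_congr rfl; intro i _
    by_cases hi : i.val < n
    · rw [if_pos hi, if_pos (by simpa using hi)]
      congr 1; simp only [Fin.val_succ]; push_cast; ring
    · rw [if_neg hi, if_neg (by simpa using hi)]
  rw [hN1, hN2]
  have hD : (∑ i : Fin m, if p i.succ < q i.castSucc then w * (x - a ((n : ℤ) + q i.castSucc - i.val)) else 0)
      - (∑ i : Fin m, if p i.succ < q i.castSucc then w * (x - a ((n : ℤ) + p i.succ - i.val)) else 0)
      = w * ((∑ i : Fin m, if i.val < n then a ((n : ℤ) + p i.succ - i.val) else 0)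
      - ∑ i : Fin m, if i.val < n then a ((n : ℤ) + q i.castSucc - i.val) else 0) := by
    rw [← Finset.sum_sub_distrib, ← Finset.sum_sub_distrib, Finset.mul_sum]
    apply Finset.sum_congr rfl; intro i _
    have := g1 i
    by_cases hi : i.val < n
    · rw [if_pos hi, if_pos hi]
      split_ifs with h
      · ring
      · have e : p i.succ = q i.castSucc := by omega
        rw [e]; ring
    · rw [if_neg hi, if_neg hi, if_neg, if_neg]
      · ring
      all_goals
        rw [hq i.castSucc (by simp; omega)]; omega
  simp only [lt_irrefl, if_false]
  linear_combination hD

lemma pieri_bad {A : Type} [CommRing A] {m : ℕ} (x : A) (a : ℤ → A) (k : ℤ)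
    (p q : Fin (m + 1) → ℕ) (hp : ∀ i : Fin m, p i.succ ≤ p i.castSucc)
    (hq : ∀ i : Fin m, q i.succ ≤ q i.castSucc)
    (hg : ¬ (shiftUp p ≤ q ∧ q ≤ p)) (i : Fin (m + 1)) :
    (if 0 < q i then rowU x a k p (dcr q i) else 0) = rowU x a k (inc p i) q := by
  rw [strip_iff] at hg
  by_cases h1 : 0 < q i ∧ (shiftUp p ≤ dcr q i ∧ dcr q i ≤ p)
  · obtain ⟨h0, h1⟩ := h1
    rw [if_pos h0, rowU, if_pos h1]
    rw [strip_iff] at h1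
    have e : q i = p i + 1 := by
      by_contra hne
      apply hg
      constructor
      · intro j
        have := h1.1 j
        by_cases hj : j.castSucc = i
        · subst hj; rw [dcr_same] at this; omega
        · rwa [dcr_ne _ hj] at this
      · intro j
        have := h1.2 j
        by_cases hj : j = i
        · subst hj; rw [dcr_same] at this; omega
        · rwa [dcr_ne _ hj] at this
    rw [rowU, if_pos, rowW_dcr_inc _ _ _ _ _ _ e]
    rw [strip_iff]
    constructor
    · intro j
      have := h1.1 j
      by_cases hj : j.succ = i
      · subst hj; rw [inc_same]; have := hq j; omega
      · rw [inc_ne _ hj]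
        by_cases hj : j.castSucc = i
        · subst hj; rw [dcr_same] at this; omega
        · rwa [dcr_ne _ hj] at this
    · intro j
      have := h1.2 j
      by_cases hj : j = i
      · subst hj; rw [inc_same]; omega
      · rwa [dcr_ne _ hj, ← inc_ne p hj] at this
  · have : (if 0 < q i then rowU x a k p (dcr q i) else 0) = 0 := by
      split_ifs with h0
      · rw [rowU, if_neg]; exact fun h => h1 ⟨h0, h⟩
      · rfl
    rw [this, rowU, if_neg]
    intro h2
    rw [strip_iff] at h2
    have e : q i = p i + 1 := by
      by_contra hne
      apply hg
      constructor
      · intro j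
        have := h2.1 j
        by_cases hj : j.succ = i
        · subst hj; rw [inc_same] at this; omega
        · rwa [inc_ne _ hj] at this
      · intro j
        have := h2.2 j
        by_cases hj : j = i
        · subst hj; rw [inc_same] at this; omega
        · rwa [inc_ne _ hj] at this
    apply h1
    refine ⟨by omega, ?_⟩
    rw [strip_iff]
    constructor
    · intro j
      by_cases hj : j.castSucc = i
      · subst hj; rw [dcr_same]; have := hp j; omega
      · rw [dcr_ne _ hj]
        have := h2.1 j
        by_cases hj : j.succ = i
        · subst hj; rw [inc_same] at this; omega
        · rwa [inc_ne _ hj] at this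
    · intro j
      have := h2.2 j
      by_cases hj : j = i
      · subst hj; rw [dcr_same]; omega
      · rwa [dcr_ne _ hj, ← inc_ne p hj]

lemma rowS_succ_U {A : Type} [CommRing A] {M : ℕ} (x : ℕ → A) (b : ℤ → A) (q : Fin M → ℕ)
    (n : ℕ) (p B : Fin M → ℕ) (hB : p ≤ B) :
    rowS x b q (n + 1) p = ∑ κ ∈ Finset.Icc 0 B, rowU (x n) b ((n : ℤ) + 1) p κ * rowS x b q n κ := by
  simp only [rowS]
  rw [← Finset.sum_subset (s₁ := Finset.Icc (shiftUp p) p) (s₂ := Finset.Icc 0 B)]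
  · apply Finset.sum_congr rfl
    intro κ hκ
    rw [Finset.mem_Icc] at hκ
    rw [rowU, if_pos hκ]
  · apply Finset.Icc_subset_Icc (fun i => Nat.zero_le _) hB
  · intro κ _ hκ
    rw [Finset.mem_Icc] at hκ
    rw [rowU, if_neg hκ, zero_mul]

lemma le_inc {M : ℕ} (p : Fin M → ℕ) (i : Fin M) : inc p i ≤ fun j => p j + 1 := by
  intro j
  by_cases h : j = i
  · subst h; rw [inc_same]
  · rw [inc_ne _ h]; exact Nat.le_succ _

lemma inc_dcr {M : ℕ} (p : Fin M → ℕ) (i : Fin M) (h : 0 < p i) : inc (dcr p i) i = p := by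
  funext j
  by_cases hj : j = i
  · subst hj; rw [inc_same, dcr_same]; omega
  · rw [inc_ne _ hj, dcr_ne _ hj]

lemma dcr_inc {M : ℕ} (p : Fin M → ℕ) (i : Fin M) : dcr (inc p i) i = p := by
  funext j
  by_cases hj : j = i
  · subst hj; rw [dcr_same, inc_same]; omega
  · rw [dcr_ne _ hj, inc_ne _ hj]

lemma pieri_reindex {A : Type} [CommRing A] {M : ℕ} (x : A) (b : ℤ → A) (k : ℤ)
    (F : (Fin M → ℕ) → A) (p : Fin M → ℕ) (i : Fin M) :
    ∑ κ ∈ Finset.Icc 0 (fun j => p j + 1), rowU x b k p κ * F (inc κ i) =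
    ∑ κ ∈ Finset.Icc 0 (fun j => p j + 1), (if 0 < κ i then rowU x b k p (dcr κ i) else 0) * F κ := by
  have : ∀ κ, (if 0 < κ i then rowU x b k p (dcr κ i) else 0) * F κ =
      if 0 < κ i then rowU x b k p (dcr κ i) * F κ else 0 := by
    intro κ; split_ifs <;> simp
  simp_rw [this]
  rw [← Finset.sum_filter]
  have h2 : ∑ κ ∈ Finset.Icc 0 (fun j => p j + 1), rowU x b k p κ * F (inc κ i) =
      ∑ κ ∈ Finset.Icc 0 p, rowU x b k p κ * F (inc κ i) := by
    symm
    apply Finset.sum_subset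
    · exact Finset.Icc_subset_Icc le_rfl (fun j => Nat.le_succ _)
    · intro κ _ hκ
      rw [rowU, if_neg, zero_mul]
      intro h
      exact hκ (Finset.mem_Icc.2 ⟨fun j => Nat.zero_le _, h.2⟩)
  have h3 : ∑ κ ∈ Finset.Icc 0 (fun j => p j + 1) with 0 < κ i, rowU x b k p (dcr κ i) * F κ =
      ∑ κ ∈ (Finset.Icc 0 p).image (fun κ => inc κ i), rowU x b k p (dcr κ i) * F κ := by
    symm
    apply Finset.sum_subset
    · intro κ hκ
      rw [Finset.mem_image] at hκ
      obtain ⟨κ, hκ, rfl⟩ := hκ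
      rw [Finset.mem_Icc] at hκ
      rw [Finset.mem_filter, Finset.mem_Icc]
      refine ⟨⟨fun j => Nat.zero_le _, (le_inc κ i).trans (fun j => Nat.succ_le_succ (hκ.2 j))⟩, ?_⟩
      rw [inc_same]; omega
    · intro κ hκ hκ'
      rw [Finset.mem_filter] at hκ
      rw [rowU, if_neg, zero_mul]
      intro h
      apply hκ'
      rw [Finset.mem_image]
      exact ⟨dcr κ i, Finset.mem_Icc.2 ⟨fun j => Nat.zero_le _, h.2⟩, inc_dcr _ _ hκ.2⟩
  rw [h2, h3, Finset.sum_image]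
  · simp_rw [dcr_inc]
  · intro κ _ κ' _ h
    have := congrArg (fun f => dcr f i) h
    simpa [dcr_inc] using this

lemma rowS_pieri {A : Type} [CommRing A] {m : ℕ} (x : ℕ → A) (a : ℤ → A) (n : ℕ)
    (hn : n ≤ m + 1) (p : Fin (m + 1) → ℕ) (hp : ∀ i : Fin m, p i.succ ≤ p i.castSucc) :
    (∑ i ∈ Finset.range n, x i - rowN a n p) * rowS x a 0 n p = ∑ i, rowS x a 0 n (inc p i) := by
  induction n generalizing p with
  | zero =>
    have : ∀ i, inc p i ≠ 0 := by
      intro i h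
      have := congrFun h i
      rw [inc_same] at this
      simp at this
    simp [rowN, rowS, this]
  | succ n ih =>
    rw [rowS_succ_U x a 0 n p (fun j => p j + 1) (fun j => Nat.le_succ _)]
    have e : ∀ i, rowS x a 0 (n + 1) (inc p i) = _ := fun i =>
      rowS_succ_U x a 0 n (inc p i) (fun j => p j + 1) (le_inc p i)
    simp_rw [e]
    rw [Finset.sum_comm, Finset.mul_sum]
    have s1 : ∀ κ ∈ Finset.Icc 0 (fun j => p j + 1),
        (∑ i ∈ Finset.range (n + 1), x i - rowN a (n + 1) p) *
          (rowU (x n) a ((n : ℤ) + 1) p κ * rowS x a 0 n κ) =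
        (∑ i, rowU (x n) a ((n : ℤ) + 1) p κ * rowS x a 0 n (inc κ i)) +
        (x n + rowN a n κ - rowN a (n + 1) p) * rowU (x n) a ((n : ℤ) + 1) p κ * rowS x a 0 n κ := by
      intro κ _
      by_cases hg : shiftUp p ≤ κ ∧ κ ≤ p
      · rw [← Finset.mul_sum, ← ih (by omega) κ, Finset.sum_range_succ]
        · ring
        · rw [strip_iff] at hg
          intro i
          exact (hg.2 _).trans (hg.1 i)
      · rw [rowU, if_neg hg]; simp
    rw [Finset.sum_congr rfl s1, Finset.sum_add_distrib, Finset.sum_comm]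
    simp_rw [pieri_reindex]
    rw [Finset.sum_comm, ← Finset.sum_add_distrib]
    apply Finset.sum_congr rfl
    intro κ _
    rw [← Finset.sum_mul, ← Finset.sum_mul, ← add_mul]
    by_cases h0 : rowS x a 0 n κ = 0
    · rw [h0]; simp
    congr 1
    by_cases hg : shiftUp p ≤ κ ∧ κ ≤ p
    · exact pieri_good (x n) a n (by omega) p κ (rowS_rows x a n κ h0) hg
    · have : rowU (x n) a ((n : ℤ) + 1) p κ = 0 := by rw [rowU, if_neg hg]
      rw [this, mul_zero, add_zero]
      apply Finset.sum_congr rfl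
      intro i _
      refine pieri_bad (x n) a _ p κ hp ?_ hg i
      intro j
      have := rowS_eq_zero_of_not_antitone x a n κ h0 j.castSucc
      simp [shiftUp] at this
      exact this

lemma antitone_of_shiftUp {M : ℕ} (p : Fin M → ℕ) (h : shiftUp p ≤ p) : Antitone p := by
  cases M with
  | zero => intro i; exact i.elim0
  | succ m =>
    rw [Fin.antitone_iff_succ_le]
    intro i
    have := h i.castSucc
    simp [shiftUp] at this
    exact this

lemma strip_lt {M : ℕ} (p κ : Fin M → ℕ) (h1 : shiftUp p ≤ κ) (h2 : κ ≤ p) {i i' : Fin M}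
    (h : i < i') : p i' ≤ κ i := by
  have hp := antitone_of_shiftUp p (h1.trans h2)
  have hlt : i.val + 1 < M := by have := i'.isLt; have : i.val < i'.val := h; omega
  have := h1 i
  simp only [shiftUp, hlt, dite_true] at this
  refine le_trans (hp ?_) this
  rw [Fin.le_def]; exact h

lemma shiftUp_le_of_antitone {M : ℕ} (p : Fin M → ℕ) (h : Antitone p) : shiftUp p ≤ p := by
  intro i
  unfold shiftUp
  split_ifs with h1
  · apply h; rw [Fin.le_def]; simp
  · exact Nat.zero_le _

def cellsF {M : ℕ} (q p : Fin M → ℕ) : Finset (ℕ × ℕ) :=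
  (Finset.univ.sigma fun i : Fin M => Finset.Ico (q i) (p i)).image fun c => (c.1.val, c.2)

lemma mem_cellsF {M : ℕ} (q p : Fin M → ℕ) (c : ℕ × ℕ) :
    c ∈ cellsF q p ↔ ∃ i : Fin M, i.val = c.1 ∧ q i ≤ c.2 ∧ c.2 < p i := by
  simp only [cellsF, Finset.mem_image, Finset.mem_sigma, Finset.mem_univ, true_and, Finset.mem_Ico]
  constructor
  · rintro ⟨⟨i, j⟩, h, rfl⟩
    exact ⟨i, rfl, h⟩
  · rintro ⟨i, h1, h2⟩
    exact ⟨⟨i, c.2⟩, h2, by simp [h1]⟩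

lemma mem_cellsF' {M : ℕ} (q p : Fin M → ℕ) (i : Fin M) (j : ℕ) :
    (i.val, j) ∈ cellsF q p ↔ q i ≤ j ∧ j < p i := by
  rw [mem_cellsF]
  constructor
  · rintro ⟨i', h, h'⟩
    obtain rfl : i' = i := Fin.ext h
    exact h'
  · intro h; exact ⟨i, rfl, h⟩

lemma prod_cellsF {A : Type} [CommRing A] {M : ℕ} (q p : Fin M → ℕ) (F : ℕ × ℕ → A) :
    ∏ c ∈ cellsF q p, F c = ∏ i : Fin M, ∏ j ∈ Finset.Ico (q i) (p i), F (i.val, j) := by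
  unfold cellsF
  rw [Finset.prod_image, Finset.prod_sigma]
  rintro ⟨i, j⟩ _ ⟨i', j'⟩ _ h
  simp only [Prod.mk.injEq] at h
  obtain ⟨h1, rfl⟩ := h
  obtain rfl := Fin.ext h1
  rfl

open Classical in
lemma sgen_eq_sum {A : Type} [CommRing A] (n : ℕ) (s : Finset (ℕ × ℕ))
    (x : Fin n → A) (a : ℤ → A) :
    sgen n s x a = ∑ T : s → Fin n with IsSsyt s T,
      ∏ c : s, (x (T c) - a ((T c : ℤ) + 1 + ((c : ℕ × ℕ).2 : ℤ) - ((c : ℕ × ℕ).1 : ℤ))) := by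
  unfold sgen
  rw [finsum_mem_def, finsum_eq_sum_of_fintype, Finset.sum_filter]
  apply Finset.sum_congr rfl
  intro T _
  simp [Set.indicator]

open Classical in
noncomputable def glue {M n : ℕ} (q p κ : Fin M → ℕ) (T : cellsF q κ → Fin n) :
    cellsF q p → Fin (n + 1) :=
  fun c => if h : c.1 ∈ cellsF q κ then (T ⟨c.1, h⟩).castSucc else Fin.last n

lemma glue_ssyt {M n : ℕ} (q p κ : Fin M → ℕ) (T : cellsF q κ → Fin n)
    (h1 : shiftUp p ≤ κ) (h2 : κ ≤ p) (hT : IsSsyt _ T) : IsSsyt _ (glue q p κ T) := by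
  have hp := antitone_of_shiftUp p (h1.trans h2)
  obtain ⟨T1, T2⟩ := hT
  constructor
  · rintro ⟨c, hc⟩ ⟨c', hc'⟩ e1 e2
    unfold glue
    by_cases h' : c' ∈ cellsF q κ
    · have h : c ∈ cellsF q κ := by
        rw [mem_cellsF] at hc h' ⊢
        obtain ⟨i, r1, r2, r3⟩ := hc
        obtain ⟨i', s1, s2, s3⟩ := h'
        obtain rfl : i = i' := Fin.ext (by rw [r1, s1]; exact e1)
        exact ⟨i, r1, r2, lt_of_le_of_lt e2 s3⟩
      simp only [h, h', dite_true]
      rw [Fin.castSucc_le_castSucc_iff]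
      exact T1 _ _ e1 e2
    · simp only [h', dite_false]
      exact Fin.le_last _
  · rintro ⟨c, hc⟩ ⟨c', hc'⟩ e1 e2
    have h : c ∈ cellsF q κ := by
      rw [mem_cellsF] at hc hc' ⊢
      obtain ⟨i, r1, r2, r3⟩ := hc
      obtain ⟨i', s1, s2, s3⟩ := hc'
      have hlt : i < i' := by rw [Fin.lt_def, r1, s1]; exact e1
      have := strip_lt p κ h1 h2 hlt
      exact ⟨i, r1, r2, by simp only at e2; omega⟩
    unfold glue
    by_cases h' : c' ∈ cellsF q κ
    · simp only [h, h', dite_true]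
      rw [Fin.castSucc_lt_castSucc_iff]
      exact T2 _ _ e1 e2
    · simp only [h, h', dite_false, dite_true]
      exact Fin.castSucc_lt_last _

lemma glue_lt_iff {M n : ℕ} (q p κ : Fin M → ℕ) (T : cellsF q κ → Fin n) (c : cellsF q p) :
    glue q p κ T c ≠ Fin.last n ↔ c.1 ∈ cellsF q κ := by
  unfold glue
  split_ifs with h
  · simp [h]
  · simp [h]

lemma glue_inj_aux {M n : ℕ} (q p κ κ' : Fin M → ℕ) (T : cellsF q κ → Fin n)
    (T' : cellsF q κ' → Fin n) (h1 : q ≤ κ) (h2' : κ' ≤ p)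
    (h : glue q p κ T = glue q p κ' T') : κ' ≤ κ := by
  intro i
  by_contra hlt
  push Not at hlt
  have hm : (i.val, κ i) ∈ cellsF q p := by
    rw [mem_cellsF']; exact ⟨h1 i, lt_of_lt_of_le hlt (h2' i)⟩
  have := glue_lt_iff q p κ T ⟨_, hm⟩
  rw [h, glue_lt_iff, mem_cellsF', mem_cellsF'] at this
  have := this.1 ⟨h1 i, hlt⟩
  omega

lemma glue_inj {M n : ℕ} (q p κ : Fin M → ℕ) (T T' : cellsF q κ → Fin n) (h2 : κ ≤ p)
    (h : glue q p κ T = glue q p κ T') : T = T' := by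
  funext ⟨c, hc⟩
  have hm : c ∈ cellsF q p := by
    rw [mem_cellsF] at hc ⊢
    obtain ⟨i, r1, r2, r3⟩ := hc
    exact ⟨i, r1, r2, lt_of_lt_of_le r3 (h2 i)⟩
  have := congrFun h ⟨c, hm⟩
  simpa [glue, hc] using this

lemma glue_surj {M n : ℕ} (q p : Fin M → ℕ) (hq : Antitone q) (hp : Antitone p) (hqp : q ≤ p)
    (T : cellsF q p → Fin (n + 1)) (hT : IsSsyt _ T) :
    ∃ κ, shiftUp p ≤ κ ∧ q ≤ κ ∧ κ ≤ p ∧ ∃ T' : cellsF q κ → Fin n, IsSsyt _ T' ∧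
      glue q p κ T' = T := by
  classical
  obtain ⟨T1, T2⟩ := hT
  let P : Fin M → ℕ → Prop := fun i j => ∃ h : (i.val, j) ∈ cellsF q p, T ⟨_, h⟩ ≠ Fin.last n
  let κ : Fin M → ℕ := fun i => max (q i) (((Finset.Ico (q i) (p i)).filter (P i)).sup (· + 1))
  have hκp : κ ≤ p := by
    intro i
    apply max_le (hqp i)
    apply Finset.sup_le
    intro j hj
    simp only [Finset.mem_filter, Finset.mem_Ico] at hj
    exact hj.1.2
  have hqκ : q ≤ κ := fun i => le_max_left _ _
  have key : ∀ i j, ∀ h : (i.val, j) ∈ cellsF q p, j < κ i ↔ T ⟨_, h⟩ ≠ Fin.last n := by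
    intro i j h
    have h' := h
    rw [mem_cellsF'] at h'
    constructor
    · intro hj
      rcases lt_max_iff.1 hj with hj | hj
      · omega
      · rw [Finset.lt_sup_iff] at hj
        obtain ⟨j', hj', hlt⟩ := hj
        simp only [Finset.mem_filter, Finset.mem_Ico] at hj'
        obtain ⟨h'', hne⟩ := hj'.2
        have := T1 ⟨_, h⟩ ⟨_, h''⟩ rfl (by simp only; omega)
        intro e
        rw [e] at this
        exact hne (Fin.last_le_iff.1 this)
    · intro hne
      apply lt_max_of_lt_right
      rw [Finset.lt_sup_iff]
      refine ⟨j, ?_, Nat.lt_succ_self _⟩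
      simp only [Finset.mem_filter, Finset.mem_Ico]
      exact ⟨h', h, hne⟩
  have hsh : shiftUp p ≤ κ := by
    intro i
    unfold shiftUp
    split_ifs with hi
    · by_contra hlt
      push Not at hlt
      set i' : Fin M := ⟨i.val + 1, hi⟩ with hi'
      have hii : i ≤ i' := by rw [Fin.le_def]; simp [hi']
      have a1 := hp hii
      have a2 := hq hii
      have a3 : q i ≤ κ i := hqκ i
      have a4 : κ i < p i' := hlt
      have m1 : (i.val, κ i) ∈ cellsF q p := by rw [mem_cellsF']; omega
      have m2 : (i'.val, κ i) ∈ cellsF q p := by rw [mem_cellsF']; omega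
      have := T2 ⟨_, m1⟩ ⟨_, m2⟩ (by simp [hi']) rfl
      have := (key i (κ i) m1).2 (this.trans_le (Fin.le_last _)).ne
      omega
    · exact Nat.zero_le _
  have hsub : ∀ c, c ∈ cellsF q κ → c ∈ cellsF q p := by
    intro c hc
    rw [mem_cellsF] at hc ⊢
    obtain ⟨i, r1, r2, r3⟩ := hc
    exact ⟨i, r1, r2, lt_of_lt_of_le r3 (hκp i)⟩
  have hin : ∀ c (h : c ∈ cellsF q p), c ∈ cellsF q κ ↔ T ⟨c, h⟩ ≠ Fin.last n := by
    intro c h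
    have h0 := h
    rw [mem_cellsF] at h
    obtain ⟨i, r1, r2, r3⟩ := h
    obtain ⟨c1, j⟩ := c
    simp only at r1
    subst r1
    rw [← key i j h0, mem_cellsF']
    simp only at r2
    tauto
  refine ⟨κ, hsh, hqκ, hκp, fun c => (T ⟨c.1, hsub _ c.2⟩).castPred ((hin _ _).1 c.2), ⟨?_, ?_⟩, ?_⟩
  · intro c c' e1 e2
    rw [Fin.castPred_le_castPred_iff]
    exact T1 _ _ e1 e2
  · intro c c' e1 e2
    rw [Fin.castPred_lt_castPred_iff]
    exact T2 _ _ e1 e2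
  · funext ⟨c, hc⟩
    unfold glue
    split_ifs with h
    · simp
    · rw [hin c hc] at h
      push Not at h
      exact h.symm

lemma glue_prod {A : Type} [CommRing A] {M n : ℕ} (q p κ : Fin M → ℕ) (T : cellsF q κ → Fin n)
    (h1 : q ≤ κ) (h2 : κ ≤ p) (x : ℕ → A) (b : ℤ → A) :
    ∏ c : cellsF q p, (x (glue q p κ T c) - b ((glue q p κ T c : ℤ) + 1 + (c.1.2 : ℤ) - (c.1.1 : ℤ))) =
    rowW (x n) b ((n : ℤ) + 1) p κ *
      ∏ c : cellsF q κ, (x (T c) - b ((T c : ℤ) + 1 + (c.1.2 : ℤ) - (c.1.1 : ℤ))) := by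
  classical
  let G : ℕ × ℕ → ℕ := fun c => if h : c ∈ cellsF q κ then (T ⟨c, h⟩).val else n
  let F : ℕ × ℕ → A := fun c => x (G c) - b ((G c : ℤ) + 1 + (c.2 : ℤ) - (c.1 : ℤ))
  have e1 : ∏ c : cellsF q p, (x (glue q p κ T c) - b ((glue q p κ T c : ℤ) + 1 + (c.1.2 : ℤ) - (c.1.1 : ℤ))) = ∏ c ∈ cellsF q p, F c := by
    rw [← Finset.prod_coe_sort (cellsF q p) F]
    apply Finset.prod_congr rfl
    intro c _
    have : (glue q p κ T c).val = G c.1 := by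
      simp only [glue, G]; split_ifs <;> simp
    simp only [F, this]
  have e2 : ∏ c : cellsF q κ, (x (T c) - b ((T c : ℤ) + 1 + (c.1.2 : ℤ) - (c.1.1 : ℤ))) = ∏ c ∈ cellsF q κ, F c := by
    rw [← Finset.prod_coe_sort (cellsF q κ) F]
    apply Finset.prod_congr rfl
    intro c _
    have : (T c).val = G c.1 := by
      simp only [G, c.2, dite_true]
    simp only [F, this]
  have e3 : rowW (x n) b ((n : ℤ) + 1) p κ = ∏ c ∈ cellsF κ p, F c := by
    rw [prod_cellsF]
    unfold rowW
    apply Finset.prod_congr rfl; intro i _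
    apply Finset.prod_congr rfl; intro j hj
    have : G (i.val, j) = n := by
      simp only [G]
      rw [dif_neg]
      rw [mem_cellsF']
      rw [Finset.mem_Ico] at hj
      omega
    simp only [F, this]
  rw [e1, e2, e3, prod_cellsF, prod_cellsF, prod_cellsF, ← Finset.prod_mul_distrib]
  apply Finset.prod_congr rfl; intro i _
  rw [mul_comm, Finset.prod_Ico_consecutive _ (h1 i) (h2 i)]

lemma rowS_ge {A : Type} [CommRing A] {M : ℕ} (x : ℕ → A) (a : ℤ → A) (q : Fin M → ℕ)
    (n : ℕ) (p : Fin M → ℕ) (h : rowS x a q n p ≠ 0) : q ≤ p := by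
  induction n generalizing p with
  | zero =>
    simp only [rowS] at h
    split_ifs at h with h0
    · exact h0.ge
    · simp at h
  | succ n ih =>
    simp only [rowS] at h
    obtain ⟨κ, hκ, hne⟩ := Finset.exists_ne_zero_of_sum_ne_zero h
    rw [Finset.mem_Icc] at hκ
    exact (ih κ (right_ne_zero_of_mul hne)).trans hκ.2

lemma sgen_eq_rowS {A : Type} [CommRing A] {M n : ℕ} (x : ℕ → A) (b : ℤ → A) (q p : Fin M → ℕ)
    (hq : Antitone q) (hp : Antitone p) (hqp : q ≤ p) :
    sgen n (cellsF q p) (fun i => x i) b = rowS x b q n p := by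
  classical
  induction n generalizing p with
  | zero =>
    rw [sgen_eq_sum]
    simp only [rowS]
    split_ifs with h
    · subst h
      have he : cellsF p p = ∅ := by
        ext c; simp [mem_cellsF]
      have : IsEmpty (cellsF p p) := by rw [he]; infer_instance
      rw [Finset.filter_true_of_mem]
      · simp
      · intro T _
        exact ⟨fun c => isEmptyElim c, fun c => isEmptyElim c⟩
    · have : ∃ i, q i < p i := by
        by_contra hh
        push Not at hh
        exact h (le_antisymm hh hqp)
      obtain ⟨i, hi⟩ := this
      have hm : (i.val, q i) ∈ cellsF q p := by rw [mem_cellsF']; omega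
      apply Finset.sum_eq_zero
      intro T
      exact (T ⟨_, hm⟩).elim0
  | succ n ih =>
    rw [sgen_eq_sum]
    simp only [rowS]
    have hsub : Finset.Icc (shiftUp p ⊔ q) p ⊆ Finset.Icc (shiftUp p) p :=
      Finset.Icc_subset_Icc le_sup_left le_rfl
    rw [← Finset.sum_subset hsub]
    swap
    · intro κ h1 h2
      by_cases h0 : rowS x b q n κ = 0
      · rw [h0, mul_zero]
      · exfalso; apply h2
        rw [Finset.mem_Icc] at h1 ⊢
        exact ⟨sup_le h1.1 (rowS_ge _ _ _ _ _ h0), h1.2⟩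
    have hk : ∀ κ ∈ Finset.Icc (shiftUp p ⊔ q) p,
        rowW (x n) b ((n : ℤ) + 1) p κ * rowS x b q n κ =
        ∑ T : cellsF q κ → Fin n with IsSsyt _ T, rowW (x n) b ((n : ℤ) + 1) p κ *
         ∏ c : cellsF q κ, (x (T c) - b ((T c : ℤ) + 1 + (c.1.2 : ℤ) - (c.1.1 : ℤ))) := by
      intro κ h
      rw [Finset.mem_Icc] at h
      have h1 : shiftUp p ≤ κ := le_sup_left.trans h.1
      have h2 : q ≤ κ := le_sup_right.trans h.1
      rw [← ih κ ?_ h2, sgen_eq_sum, Finset.mul_sum]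
      intro i i' hii
      rcases hii.eq_or_lt with rfl | hlt
      · exact le_rfl
      · exact (h.2 i').trans (strip_lt p κ h1 h.2 hlt)
    rw [Finset.sum_congr rfl hk, Finset.sum_sigma']
    symm
    apply Finset.sum_bij (fun (y : (κ : Fin M → ℕ) × (cellsF q κ → Fin n)) _ => glue q p y.1 y.2)
    · rintro ⟨κ, T⟩ h
      simp only [Finset.mem_sigma, Finset.mem_Icc, Finset.mem_filter, Finset.mem_univ, true_and] at h ⊢
      exact glue_ssyt q p κ T (le_sup_left.trans h.1.1) h.1.2 h.2
    · rintro ⟨κ, T⟩ h ⟨κ', T'⟩ h' e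
      simp only [Finset.mem_sigma, Finset.mem_Icc, Finset.mem_filter, Finset.mem_univ, true_and] at h h'
      simp only at e
      obtain rfl : κ = κ' := le_antisymm
        (glue_inj_aux q p κ' κ T' T (le_sup_right.trans h'.1.1) h.1.2 e.symm)
        (glue_inj_aux q p κ κ' T T' (le_sup_right.trans h.1.1) h'.1.2 e)
      rw [glue_inj q p κ T T' h.1.2 e]
    · intro T hT
      simp only [Finset.mem_filter, Finset.mem_univ, true_and] at hT
      obtain ⟨κ, a1, a2, a3, T', a4, a5⟩ := glue_surj q p hq hp hqp T hT
      refine ⟨⟨κ, T'⟩, ?_, a5⟩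
      simp only [Finset.mem_sigma, Finset.mem_Icc, Finset.mem_filter, Finset.mem_univ, true_and]
      exact ⟨⟨sup_le a1 a2, a3⟩, a4⟩
    · rintro ⟨κ, T⟩ h
      simp only [Finset.mem_sigma, Finset.mem_Icc, Finset.mem_filter, Finset.mem_univ, true_and] at h
      exact (glue_prod q p κ T (le_sup_right.trans h.1.1) h.1.2 x b).symm

lemma uniq_nonsym {R : Type} [CommRing R] [IsDomain R] (n d : ℕ) (a : ℕ → R)
    (ha : Function.Injective a) (f : MvPolynomial (Fin n) R) (hd : f.totalDegree ≤ d)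
    (hv : ∀ m : Fin n → ℕ, ∑ i, m i ≤ d → MvPolynomial.eval (fun i => a (m i)) f = 0) : f = 0 := by
  induction n generalizing d with
  | zero =>
    have := hv (fun _ => 0) (by simp)
    rw [MvPolynomial.eq_C_of_isEmpty f] at this ⊢
    simp at this
    rw [this, map_zero]
  | succ n ih =>
    by_contra hf
    set F := MvPolynomial.finSuccEquiv R n f with hF
    have hF0 : F ≠ 0 := by
      intro h
      apply hf
      exact (MvPolynomial.finSuccEquiv R n).injective (by rw [← hF, h, map_zero])
    have hlc : F.coeff F.natDegree ≠ 0 := by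
      rw [Polynomial.coeff_natDegree]; exact Polynomial.leadingCoeff_ne_zero.2 hF0
    have hdeg := MvPolynomial.totalDegree_coeff_finSuccEquiv_add_le f F.natDegree hlc
    apply hlc
    apply ih (d - F.natDegree) _ (by rw [← hF] at hdeg; omega)
    intro m hm
    rw [← hF] at hdeg
    have hz : Polynomial.map (MvPolynomial.eval (fun i => a (m i))) F = 0 := by
      apply Polynomial.eq_zero_of_natDegree_lt_card_of_eval_eq_zero (ι := Fin (F.natDegree + 1))
        _ (f := fun i => a i.val)
      · intro i j h; exact Fin.ext (ha h)
      · intro i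
        obtain ⟨i, hi⟩ := i
        simp only
        rw [← MvPolynomial.eval_eq_eval_mv_eval']
        have := hv (Fin.cons i m) (by rw [Fin.sum_univ_succ]; simp; omega)
        rw [← this]
        congr 1
        congr 1
        funext j
        refine Fin.cases ?_ (fun j => ?_) j <;> simp
      · rw [Fintype.card_fin]
        exact Nat.lt_succ_of_le Polynomial.natDegree_map_le
    have := congrArg (fun P => Polynomial.coeff P F.natDegree) hz
    simpa [Polynomial.coeff_map] using this

noncomputable def vdm (R : Type) [CommRing R] (n : ℕ) : MvPolynomial (Fin n) R :=
  ∏ i : Fin n, ∏ j ∈ Finset.Iio i, (MvPolynomial.X i - MvPolynomial.X j)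

lemma vdm_ne {R : Type} [CommRing R] [IsDomain R] (n : ℕ) : vdm R n ≠ 0 := by
  unfold vdm
  rw [Finset.prod_ne_zero_iff]
  intro i _
  rw [Finset.prod_ne_zero_iff]
  intro j hj h
  rw [sub_eq_zero] at h
  have := MvPolynomial.X_injective h
  rw [Finset.mem_Iio] at hj
  exact hj.ne this.symm

lemma vdm_deg {R : Type} [CommRing R] [IsDomain R] (n : ℕ) :
    (vdm R n).totalDegree ≤ ∑ i : Fin n, i.val := by
  unfold vdm
  refine (MvPolynomial.totalDegree_finsetProd _ _).trans (Finset.sum_le_sum fun i _ => ?_)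
  refine (MvPolynomial.totalDegree_finsetProd _ _).trans ?_
  calc _ ≤ ∑ j ∈ Finset.Iio i, 1 := Finset.sum_le_sum fun j _ => by
        refine (MvPolynomial.totalDegree_sub _ _).trans ?_
        simp
    _ = i.val := by simp

lemma le_of_strictMono {n : ℕ} (g : Fin n → ℕ) (hg : StrictMono g) (i : Fin n) : i.val ≤ g i := by
  obtain ⟨i, hi⟩ := i
  induction i with
  | zero => exact Nat.zero_le _
  | succ i ih =>
    have h1 := ih (by omega)
    have h2 : g ⟨i, by omega⟩ < g ⟨i + 1, hi⟩ := hg (by simp)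
    simp only at *
    omega

lemma uniq_sym {R : Type} [CommRing R] [IsDomain R] (n d : ℕ) (a : ℕ → R)
    (ha : Function.Injective a) (f : MvPolynomial (Fin n) R) (hd : f.totalDegree ≤ d)
    (hs : ∀ (σ : Equiv.Perm (Fin n)) (y : Fin n → R),
      MvPolynomial.eval (y ∘ σ) f = MvPolynomial.eval y f)
    (hv : ∀ ρ : Fin n → ℕ, Monotone ρ → ∑ i, ρ i ≤ d →
      MvPolynomial.eval (fun i => a (ρ i + i.val)) f = 0) : f = 0 := by
  have h := uniq_nonsym n (d + ∑ i : Fin n, i.val) a ha (f * vdm R n)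
    ((MvPolynomial.totalDegree_mul _ _).trans (Nat.add_le_add hd (vdm_deg n))) ?_
  · exact (mul_eq_zero.1 h).resolve_right (vdm_ne n)
  intro m hm
  rw [map_mul]
  by_cases hinj : Function.Injective m
  · have hmono := Tuple.monotone_sort m
    have hst : StrictMono (m ∘ Tuple.sort m) :=
      hmono.strictMono_of_injective (hinj.comp (Tuple.sort m).injective)
    set g := m ∘ Tuple.sort m with hg
    have hle := le_of_strictMono g hst
    have := hv (fun i => g i - i.val) ?_ ?_
    · have e : (fun i : Fin n => a (g i - i.val + i.val)) = (fun i => a (m i)) ∘ Tuple.sort m := by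
        funext i
        rw [Nat.sub_add_cancel (hle i)]; rfl
      rw [e, hs] at this
      rw [this, zero_mul]
    · cases n with
      | zero => intro i; exact i.elim0
      | succ n =>
        rw [Fin.monotone_iff_le_succ]
        intro i
        have h1 : g i.castSucc < g i.succ := hst (Fin.castSucc_lt_succ)
        simp only [Fin.val_succ, Fin.val_castSucc]
        omega
    · have e1 : ∑ i, g i = ∑ i, m i := Equiv.sum_comp (Tuple.sort m) m
      have e2 : ∑ i, (g i - i.val) + ∑ i : Fin n, i.val = ∑ i, g i := by
        rw [← Finset.sum_add_distrib]
        exact Finset.sum_congr rfl fun i _ => Nat.sub_add_cancel (hle i)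
      omega
  · have : ∃ i j, j < i ∧ m i = m j := by
      unfold Function.Injective at hinj
      push Not at hinj
      obtain ⟨i, j, h1, h2⟩ := hinj
      rcases lt_or_gt_of_ne h2 with h | h
      · exact ⟨j, i, h, h1.symm⟩
      · exact ⟨i, j, h, h1⟩
    obtain ⟨i, j, hij, e⟩ := this
    have : MvPolynomial.eval (fun i => a (m i)) (vdm R n) = 0 := by
      unfold vdm
      rw [map_prod]
      apply Finset.prod_eq_zero (Finset.mem_univ i)
      rw [map_prod]
      apply Finset.prod_eq_zero (Finset.mem_Iio.2 hij)
      simp [e]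
    rw [this, mul_zero]

def rl (n : ℕ) (μ : YoungDiagram) : Fin n → ℕ := fun i => μ.rowLen i.val

lemma rl_anti (n : ℕ) (μ : YoungDiagram) : Antitone (rl n μ) := by
  intro i j h
  exact μ.rowLen_anti _ _ h

lemma colLen_mono {μ ν : YoungDiagram} (h : μ ≤ ν) : μ.colLen 0 ≤ ν.colLen 0 := by
  by_contra hlt
  push Not at hlt
  have h1 : (ν.colLen 0, 0) ∈ μ := YoungDiagram.mem_iff_lt_colLen.2 hlt
  have h2 : (ν.colLen 0, 0) ∈ ν := h h1
  exact lt_irrefl _ (YoungDiagram.mem_iff_lt_colLen.1 h2)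

lemma rowLen_mono {μ ν : YoungDiagram} (h : μ ≤ ν) (i : ℕ) : μ.rowLen i ≤ ν.rowLen i := by
  by_contra hlt
  push Not at hlt
  have h1 : (i, ν.rowLen i) ∈ μ := YoungDiagram.mem_iff_lt_rowLen.2 hlt
  have h2 : (i, ν.rowLen i) ∈ ν := h h1
  exact lt_irrefl _ (YoungDiagram.mem_iff_lt_rowLen.1 h2)

lemma row_lt {n : ℕ} {μ : YoungDiagram} (h : μ.colLen 0 ≤ n) {c : ℕ × ℕ} (hc : c ∈ μ) :
    c.1 < n := by
  have : (c.1, 0) ∈ μ := μ.up_left_mem le_rfl (Nat.zero_le c.2) hc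
  exact lt_of_lt_of_le (YoungDiagram.mem_iff_lt_colLen.1 this) h

lemma skewCells_eq {M : ℕ} (θi θo : YoungDiagram) (h : θo.colLen 0 ≤ M) :
    skewCells θi θo = cellsF (rl M θi) (rl M θo) := by
  ext ⟨i, j⟩
  rw [mem_cellsF]
  simp only [skewCells, Finset.mem_sdiff, YoungDiagram.mem_cells]
  constructor
  · rintro ⟨h1, h2⟩
    refine ⟨⟨i, row_lt h h1⟩, rfl, ?_, YoungDiagram.mem_iff_lt_rowLen.1 h1⟩
    rw [YoungDiagram.mem_iff_lt_rowLen] at h2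
    exact not_lt.1 h2
  · rintro ⟨i', rfl, h1, h2⟩
    rw [YoungDiagram.mem_iff_lt_rowLen, YoungDiagram.mem_iff_lt_rowLen]
    exact ⟨h2, not_lt.2 h1⟩

lemma cells_eq {n : ℕ} (μ : YoungDiagram) (h : μ.colLen 0 ≤ n) :
    μ.cells = cellsF 0 (rl n μ) := by
  ext ⟨i, j⟩
  rw [mem_cellsF]
  simp only [YoungDiagram.mem_cells]
  constructor
  · intro h1
    exact ⟨⟨i, row_lt h h1⟩, rfl, Nat.zero_le _, YoungDiagram.mem_iff_lt_rowLen.1 h1⟩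
  · rintro ⟨i', rfl, h1, h2⟩
    rw [YoungDiagram.mem_iff_lt_rowLen]
    exact h2

lemma extF_val {A : Type} [CommRing A] {n : ℕ} (x : Fin n → A) :
    (fun i : Fin n => extF x i.val) = x := by
  funext i; simp [extF]

lemma sgen_straight {A : Type} [CommRing A] {n : ℕ} (x : Fin n → A) (a : ℤ → A)
    (μ : YoungDiagram) (h : μ.colLen 0 ≤ n) :
    sgen n μ.cells x a = rowS (extF x) a 0 n (rl n μ) := by
  rw [cells_eq μ h, ← sgen_eq_rowS (extF x) a 0 (rl n μ) (fun _ _ _ => le_rfl) (rl_anti n μ)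
    (fun _ => Nat.zero_le _), extF_val]

lemma sgen_skew {A : Type} [CommRing A] {n : ℕ} (x : Fin n → A) (a : ℤ → A)
    (θi θo : YoungDiagram) (h : θi ≤ θo) :
    sgen n (skewCells θi θo) x a =
      rowS (extF x) a (rl (θo.colLen 0) θi) n (rl (θo.colLen 0) θo) := by
  rw [skewCells_eq θi θo le_rfl, ← sgen_eq_rowS (extF x) a _ _ (rl_anti _ _) (rl_anti _ _)
    (fun i => rowLen_mono h i), extF_val]

lemma sgen_straight_symm {A : Type} [CommRing A] {n : ℕ} (x : Fin n → A) (a : ℤ → A)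
    (μ : YoungDiagram) (h : μ.colLen 0 ≤ n) (σ : Equiv.Perm (Fin n)) :
    sgen n μ.cells (x ∘ σ) a = sgen n μ.cells x a := by
  rw [sgen_straight _ _ _ h, sgen_straight _ _ _ h, rowS_perm]

lemma sgen_skew_symm {A : Type} [CommRing A] {n : ℕ} (x : Fin n → A) (a : ℤ → A)
    (θi θo : YoungDiagram) (h : θi ≤ θo) (σ : Equiv.Perm (Fin n)) :
    sgen n (skewCells θi θo) (x ∘ σ) a = sgen n (skewCells θi θo) x a := by
  rw [sgen_skew _ _ _ _ h, sgen_skew _ _ _ _ h, rowS_perm]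

lemma sgen_map {A B : Type} [CommRing A] [CommRing B] (φ : A →+* B) (n : ℕ) (s : Finset (ℕ × ℕ))
    (x : Fin n → A) (a : ℤ → A) :
    φ (sgen n s x a) = sgen n s (fun i => φ (x i)) (fun k => φ (a k)) := by
  rw [sgen_eq_sum, sgen_eq_sum, map_sum]
  apply Finset.sum_congr rfl
  intro T _
  rw [map_prod]
  simp

lemma sgen_deg {R : Type} [CommRing R] [Nontrivial R] (n : ℕ) (s : Finset (ℕ × ℕ)) (a : ℤ → R) :
    (sgen n s (fun i => (MvPolynomial.X i : MvPolynomial (Fin n) R))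
      (fun k => MvPolynomial.C (a k))).totalDegree ≤ s.card := by
  rw [sgen_eq_sum]
  apply MvPolynomial.totalDegree_finsetSum_le
  intro T _
  refine (MvPolynomial.totalDegree_finsetProd _ _).trans ?_
  refine (Finset.sum_le_card_nsmul _ _ 1 ?_).trans ?_
  · intro c _
    exact (MvPolynomial.totalDegree_sub_C_le _ _).trans (MvPolynomial.totalDegree_X _).le
  · simp

def mkYD {n : ℕ} (p : Fin n → ℕ) (hp : Antitone p) : YoungDiagram where
  cells := cellsF 0 p
  isLowerSet := by
    rintro ⟨i, j⟩ ⟨i', j'⟩ hle hm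
    obtain ⟨h1, h2⟩ := Prod.mk_le_mk.1 hle
    simp only [Finset.mem_coe, mem_cellsF] at hm ⊢
    obtain ⟨k, rfl, _, h3⟩ := hm
    refine ⟨⟨i', lt_of_le_of_lt h1 k.isLt⟩, rfl, Nat.zero_le _, ?_⟩
    have := hp (show (⟨i', lt_of_le_of_lt h1 k.isLt⟩ : Fin n) ≤ k from h1)
    exact lt_of_le_of_lt h2 (lt_of_lt_of_le h3 this)

lemma mem_mkYD {n : ℕ} (p : Fin n → ℕ) (hp : Antitone p) (c : ℕ × ℕ) :
    c ∈ mkYD p hp ↔ ∃ i : Fin n, i.val = c.1 ∧ c.2 < p i := by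
  rw [← YoungDiagram.mem_cells]
  simp [mkYD, mem_cellsF]

lemma rl_mkYD {n : ℕ} (p : Fin n → ℕ) (hp : Antitone p) : rl n (mkYD p hp) = p := by
  funext i
  apply le_antisymm
  · by_contra hlt
    push Not at hlt
    have := YoungDiagram.mem_iff_lt_rowLen.2 hlt
    rw [mem_mkYD] at this
    obtain ⟨k, h1, h2⟩ := this
    obtain rfl := Fin.ext h1
    exact lt_irrefl _ h2
  · by_contra hlt
    push Not at hlt
    have := (mem_mkYD p hp (i.val, rl n (mkYD p hp) i)).2 ⟨i, rfl, hlt⟩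
    exact lt_irrefl _ (YoungDiagram.mem_iff_lt_rowLen.1 this)

lemma colLen_mkYD {n : ℕ} (p : Fin n → ℕ) (hp : Antitone p) : (mkYD p hp).colLen 0 ≤ n := by
  by_contra hlt
  push Not at hlt
  have := YoungDiagram.mem_iff_lt_colLen.2 hlt
  rw [mem_mkYD] at this
  obtain ⟨k, h1, h2⟩ := this
  have := k.isLt
  simp only at h1
  omega

lemma le_iff_rl {n : ℕ} {μ ν : YoungDiagram} (h : μ.colLen 0 ≤ n) :
    μ ≤ ν ↔ rl n μ ≤ rl n ν := by
  constructor
  · intro hle i; exact rowLen_mono hle i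
  · rintro hle ⟨i, j⟩ hm
    have := row_lt h hm
    have h2 := hle ⟨i, this⟩
    have h3 := YoungDiagram.mem_iff_lt_rowLen.1 hm
    exact YoungDiagram.mem_iff_lt_rowLen.2 (lt_of_lt_of_le h3 h2)

lemma rl_inj {n : ℕ} {μ ν : YoungDiagram} (h : μ.colLen 0 ≤ n) (h' : ν.colLen 0 ≤ n)
    (e : rl n μ = rl n ν) : μ = ν :=
  le_antisymm ((le_iff_rl h).2 e.le) ((le_iff_rl h').2 e.ge)

lemma card_eq_rl {n : ℕ} {μ : YoungDiagram} (h : μ.colLen 0 ≤ n) : μ.card = ∑ i, rl n μ i := by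
  unfold YoungDiagram.card
  rw [cells_eq μ h, cellsF, Finset.card_image_of_injOn]
  · simp
  · rintro ⟨i, j⟩ _ ⟨i', j'⟩ _ h
    simp only [Prod.mk.injEq] at h
    obtain ⟨h1, rfl⟩ := h
    obtain rfl := Fin.ext h1
    rfl

lemma sum_inc {n : ℕ} (p : Fin n → ℕ) (i : Fin n) : ∑ j, inc p i j = ∑ j, p j + 1 := by
  unfold inc
  rw [Finset.sum_update_of_mem (Finset.mem_univ i),
    ← Finset.add_sum_erase _ p (Finset.mem_univ i), Finset.sdiff_singleton_eq_erase]
  omega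

lemma covers_inc {n : ℕ} {μ ν : YoungDiagram} (h : ν.colLen 0 ≤ n) (hc : Covers μ ν) :
    ∃ i : Fin n, rl n ν = inc (rl n μ) i := by
  obtain ⟨hle, hcard⟩ := hc
  have hμ := (colLen_mono hle).trans h
  have hl := (le_iff_rl hμ).1 hle
  rw [card_eq_rl h, card_eq_rl hμ] at hcard
  have hex : ∃ i, rl n μ i < rl n ν i := by
    by_contra hno
    push Not at hno
    have := Finset.sum_le_sum (fun i (_ : i ∈ Finset.univ) => hno i)
    omega
  obtain ⟨i, hi⟩ := hex
  refine ⟨i, ?_⟩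
  have hle2 : inc (rl n μ) i ≤ rl n ν := by
    intro j
    by_cases hj : j = i
    · subst hj; rw [inc_same]; exact hi
    · rw [inc_ne _ hj]; exact hl j
  have hs := sum_inc (rl n μ) i
  have := (Finset.sum_eq_sum_iff_of_le (fun j (_ : j ∈ Finset.univ) => hle2 j)).1 (by omega)
  funext j
  exact (this j (Finset.mem_univ j)).symm

lemma finite_below (ρ : YoungDiagram) : {ν : YoungDiagram | ν ≤ ρ}.Finite := by
  apply Set.Finite.of_finite_image (f := fun ν : YoungDiagram => ν.cells)
  · apply (Finset.finite_toSet ρ.cells.powerset).subset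
    rintro _ ⟨ν, h, rfl⟩
    simp only [Finset.coe_powerset, Set.mem_preimage, Set.mem_powerset_iff, Finset.coe_subset]
    exact YoungDiagram.cells_subset_iff.2 h
  · intro ν _ ν' _ h
    exact YoungDiagram.ext h

noncomputable def below (ρ : YoungDiagram) : Finset YoungDiagram := (finite_below ρ).toFinset

lemma mem_below {ρ ν : YoungDiagram} : ν ∈ below ρ ↔ ν ≤ ρ := by simp [below]

/-- the point `a_ρ` listed in increasing order -/
noncomputable def ptR {A : Type} [CommRing A] (n : ℕ) (a : ℤ → A) (ρ : YoungDiagram) : ℕ → A :=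
  extF (subA n a ρ ∘ (Fin.revPerm : Equiv.Perm (Fin n)))

lemma sgen_ptR {A : Type} [CommRing A] {n : ℕ} (a : ℤ → A)
    (μ ρ : YoungDiagram) (h : μ.colLen 0 ≤ n) :
    sgen n μ.cells (subA n a ρ) a = rowS (ptR n a ρ) a 0 n (rl n μ) := by
  rw [sgen_straight _ _ _ h, ptR, rowS_perm]

lemma ptR_eq {A : Type} [CommRing A] {n : ℕ} (a : ℤ → A) (ρ : YoungDiagram) (i : ℕ) (hi : i < n) :
    ptR n a ρ i = a ((ρ.rowLen (n - 1 - i) : ℤ) + i + 1) := by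
  have : n - (i + 1) = n - 1 - i := by omega
  simp only [ptR, extF, hi, dite_true, Function.comp, Fin.revPerm_apply, subA, Fin.val_rev, this]
  congr 1
  omega

lemma rowS_ptR_le {A : Type} [CommRing A] {n : ℕ} (a : ℤ → A)
    (ρ : YoungDiagram) (p : Fin n → ℕ) (h : rowS (ptR n a ρ) a 0 n p ≠ 0) : p ≤ rl n ρ := by
  intro i
  have := rowS_vanish (ptR n a ρ) a n ρ.rowLen (fun i j h => ρ.rowLen_anti i j h)
    (fun i hi => ptR_eq a ρ i hi) p h i
  simpa [rl] using this

lemma sgen_vanish {A : Type} [CommRing A] {n : ℕ} (a : ℤ → A)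
    (μ ρ : YoungDiagram) (h : μ.colLen 0 ≤ n) (hle : ¬ μ ≤ ρ) :
    sgen n μ.cells (subA n a ρ) a = 0 := by
  rw [sgen_ptR _ _ _ h]
  by_contra hne
  exact hle ((le_iff_rl h).2 (rowS_ptR_le a ρ _ hne))

open Classical in
lemma pieri_diag {A : Type} [CommRing A] {n : ℕ} (a : ℤ → A)
    (μ ρ : YoungDiagram) (hμ : μ.colLen 0 ≤ n) (hρ : ρ.colLen 0 ≤ n) :
    (aNorm n a ρ - aNorm n a μ) * sgen n μ.cells (subA n a ρ) a =
      ∑ ν ∈ (below ρ).filter (Covers μ), sgen n ν.cells (subA n a ρ) a := by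
  cases n with
  | zero =>
    have h1 : ∀ ν ∈ (below ρ).filter (Covers μ), sgen 0 ν.cells (subA 0 a ρ) a = 0 := by
      intro ν hν
      simp only [Finset.mem_filter, mem_below] at hν
      obtain ⟨i, _⟩ := covers_inc ((colLen_mono hν.1).trans hρ) hν.2
      exact i.elim0
    rw [Finset.sum_eq_zero h1]
    simp [aNorm]
  | succ m =>
    have hP := rowS_pieri (ptR (m + 1) a ρ) a (m + 1) le_rfl (rl (m + 1) μ)
      (fun i => rl_anti _ _ (Fin.castSucc_le_succ i))
    rw [sgen_ptR _ _ _ hμ]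
    have e1 : ∑ i ∈ Finset.range (m + 1), ptR (m + 1) a ρ i = aNorm (m + 1) a ρ := by
      rw [Finset.sum_range, ptR, aNorm, ← Equiv.sum_comp Fin.revPerm (subA (m + 1) a ρ)]
      apply Finset.sum_congr rfl
      intro i _
      have := i.isLt
      simp [extF]
      omega
    have e2 : rowN a (m + 1) (rl (m + 1) μ) = aNorm (m + 1) a μ := by
      unfold rowN aNorm
      apply Finset.sum_congr rfl
      intro i _
      have := i.isLt
      simp [subA, rl]
      omega
    rw [e1, e2] at hP
    rw [hP]
    refine Finset.sum_bij_ne_zero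
      (fun i _ h => mkYD (inc (rl (m + 1) μ) i)
        (antitone_of_shiftUp _ (rowS_eq_zero_of_not_antitone _ _ _ _ h))) ?_ ?_ ?_ ?_
    · intro i _ h
      have hle := rowS_ptR_le _ _ _ h
      simp only [Finset.mem_filter, mem_below]
      refine ⟨?_, ?_, ?_⟩
      · rw [le_iff_rl (colLen_mkYD _ _), rl_mkYD]; exact hle
      · rw [le_iff_rl hμ, rl_mkYD]
        intro j
        by_cases hj : j = i
        · subst hj; rw [inc_same]; exact Nat.le_succ _
        · rw [inc_ne _ hj]
      · rw [card_eq_rl (colLen_mkYD _ _), rl_mkYD, card_eq_rl hμ, sum_inc]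
    · intro i _ h i' _ h' e
      have := congrArg (rl (m + 1)) e
      rw [rl_mkYD, rl_mkYD] at this
      by_contra hne
      have := congrFun this i
      rw [inc_same, inc_ne _ hne] at this
      omega
    · intro ν hν hne
      simp only [Finset.mem_filter, mem_below] at hν
      have hcol := (colLen_mono hν.1).trans hρ
      obtain ⟨i, hi⟩ := covers_inc hcol hν.2
      rw [sgen_ptR _ _ _ hcol, hi] at hne
      refine ⟨i, Finset.mem_univ i, hne, ?_⟩
      apply rl_inj (colLen_mkYD _ _) hcol
      rw [rl_mkYD, hi]
    · intro i _ h
      rw [sgen_ptR _ _ _ (colLen_mkYD _ _), rl_mkYD]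

lemma chain_le (ρ : YoungDiagram) : ∀ (L : List YoungDiagram) (μ : YoungDiagram),
    (μ :: L).IsChain Covers → (μ :: L).getLast? = some ρ → μ ≤ ρ ∧ ρ.card = μ.card + L.length := by
  intro L
  induction L with
  | nil =>
    intro μ _ h
    simp at h
    subst h
    exact ⟨le_rfl, by simp⟩
  | cons σ L ih =>
    intro μ hc h
    rw [List.isChain_cons_cons] at hc
    rw [List.getLast?_cons_cons] at h
    obtain ⟨h1, h2⟩ := ih σ hc.2 h
    refine ⟨hc.1.1.trans h1, ?_⟩
    rw [h2, hc.1.2, List.length_cons]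
    omega

lemma chainSet_le {μ ρ : YoungDiagram} {L : List YoungDiagram} (h : L ∈ chainSet μ ρ) :
    μ ≤ ρ ∧ L.length = ρ.card - μ.card + 1 := by
  obtain ⟨h1, h2, h3⟩ := h
  cases L with
  | nil => simp at h2
  | cons σ L =>
    simp at h2
    subst h2
    have := chain_le ρ L σ h1 h3
    refine ⟨this.1, ?_⟩
    rw [List.length_cons]
    omega

lemma chainSet_empty {μ ρ : YoungDiagram} (h : ¬ μ ≤ ρ) : chainSet μ ρ = ∅ := by
  ext L
  simp only [Set.mem_empty_iff_false, iff_false]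
  exact fun hL => h (chainSet_le hL).1

lemma chainSet_self (μ : YoungDiagram) : chainSet μ μ = {[μ]} := by
  ext L
  simp only [Set.mem_singleton_iff]
  constructor
  · intro hL
    have := (chainSet_le hL).2
    obtain ⟨h1, h2, h3⟩ := hL
    rw [Nat.sub_self, zero_add, List.length_eq_one_iff] at this
    obtain ⟨σ, rfl⟩ := this
    simpa using h2
  · rintro rfl
    exact ⟨List.isChain_singleton _, rfl, rfl⟩

lemma chainSet_cons {μ ρ : YoungDiagram} (h : μ ≠ ρ) :
    chainSet μ ρ = ⋃ σ ∈ {σ | σ ≤ ρ ∧ Covers μ σ}, (fun L => μ :: L) '' chainSet σ ρ := by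
  ext L
  simp only [Set.mem_iUnion, Set.mem_ofPred_eq, Set.mem_image]
  constructor
  · rintro ⟨h1, h2, h3⟩
    cases L with
    | nil => simp at h2
    | cons τ L =>
      simp at h2
      subst h2
      cases L with
      | nil => simp at h3; exact absurd h3 h
      | cons σ L =>
        change List.IsChain _ _ at h1
        rw [List.isChain_cons_cons] at h1
        rw [List.getLast?_cons_cons] at h3
        have hm : (σ :: L) ∈ chainSet σ ρ := ⟨h1.2, by simp, h3⟩
        exact ⟨σ, ⟨(chainSet_le hm).1, h1.1⟩, σ :: L, hm, rfl⟩
  · rintro ⟨σ, ⟨hσ, hc⟩, L', ⟨h1, h2, h3⟩, rfl⟩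
    cases L' with
    | nil => simp at h2
    | cons τ L =>
      simp at h2
      subst h2
      refine ⟨List.isChain_cons_cons.2 ⟨hc, h1⟩, by simp, ?_⟩
      rw [List.getLast?_cons_cons]
      exact h3

lemma chainSet_concat {μ ρ : YoungDiagram} (h : μ ≠ ρ) :
    chainSet μ ρ = ⋃ σ ∈ {σ | σ ≤ ρ ∧ Covers σ ρ}, (fun L => L ++ [ρ]) '' chainSet μ σ := by
  ext L
  simp only [Set.mem_iUnion, Set.mem_ofPred_eq, Set.mem_image]
  constructor
  · rintro ⟨h1, h2, h3⟩
    rcases List.eq_nil_or_concat L with rfl | ⟨L', τ, rfl⟩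
    · simp at h2
    · simp at h3
      subst h3
      rcases List.eq_nil_or_concat L' with rfl | ⟨L'', σ, rfl⟩
      · simp at h2; exact absurd h2.symm h
      · change List.IsChain _ _ at h1
        rw [List.concat_eq_append, List.isChain_append] at h1
        have hc : Covers σ τ := h1.2.2 σ (by simp) τ (by simp)
        refine ⟨σ, ⟨hc.1, hc⟩, L''.concat σ, ⟨h1.1, ?_, by simp⟩, by simp⟩
        rw [List.concat_eq_append, List.head?_append] at h2
        have : ∃ x, (L''.concat σ).head? = some x := by
          cases L'' <;> simp
        obtain ⟨x, hx⟩ := this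
        rw [hx] at h2 ⊢
        simpa using h2
  · rintro ⟨σ, ⟨hσ, hc⟩, L', ⟨h1, h2, h3⟩, rfl⟩
    refine ⟨?_, ?_, by simp⟩
    · change List.IsChain _ _
      rw [List.isChain_append]
      refine ⟨h1, by simp, ?_⟩
      intro x hx y hy
      rw [h3] at hx
      simp at hx hy
      subst hx; subst hy
      exact hc
    · rw [List.head?_append, h2]; rfl

lemma chainSet_finite (μ ρ : YoungDiagram) : (chainSet μ ρ).Finite := by
  by_cases hle : μ ≤ ρ
  swap
  · rw [chainSet_empty hle]; exact Set.finite_empty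
  induction hk : ρ.card - μ.card using Nat.strong_induction_on generalizing μ with
  | _ k ih =>
  by_cases h : μ = ρ
  · subst h; rw [chainSet_self]; exact Set.finite_singleton _
  · rw [chainSet_cons h]
    apply Set.Finite.biUnion ((finite_below ρ).subset (fun σ hσ => hσ.1))
    rintro σ ⟨h1, h2⟩
    apply Set.Finite.image
    have hcard : σ.card ≤ ρ.card := Finset.card_le_card (YoungDiagram.cells_subset_iff.2 h1)
    have := h2.2
    exact ih (ρ.card - σ.card) (by omega) σ h1 rfl

lemma finset_setOf {P : YoungDiagram → Prop} [DecidablePred P] (ρ : YoungDiagram) :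
    {σ | σ ≤ ρ ∧ P σ} = (((below ρ).filter P : Finset YoungDiagram) : Set YoungDiagram) := by
  ext σ; simp [mem_below]

section
variable {K : Type} [Field K] (n : ℕ) (a : ℤ → K)

lemma H_self (μ : YoungDiagram) : H n a μ μ = 1 := by
  simp [H, chainSet_self]

lemma H'_self (μ : YoungDiagram) : H' n a μ μ = 1 := by
  simp [H', chainSet_self]

lemma H_zero {μ ρ : YoungDiagram} (h : ¬ μ ≤ ρ) : H n a μ ρ = 0 := by
  rw [H, chainSet_empty h, finsum_mem_empty]

lemma H'_zero {μ ρ : YoungDiagram} (h : ¬ μ ≤ ρ) : H' n a μ ρ = 0 := by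
  rw [H', chainSet_empty h, finsum_mem_empty]

open Classical in
lemma H_rec {μ ρ : YoungDiagram} (h : μ ≠ ρ) :
    H n a μ ρ = (aNorm n a ρ - aNorm n a μ)⁻¹ * ∑ σ ∈ (below ρ).filter (Covers μ), H n a σ ρ := by
  conv_lhs => rw [H, chainSet_cons h]
  rw [finsum_mem_biUnion, finset_setOf, finsum_mem_coe_finset, Finset.mul_sum]
  · apply Finset.sum_congr rfl
    intro σ _
    rw [finsum_mem_image (fun L _ L' _ h => List.tail_eq_of_cons_eq h), H, mul_finsum_mem]
    apply finsum_mem_congr rfl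
    rintro L ⟨_, h2, _⟩
    cases L with
    | nil => simp at h2
    | cons τ L => simp
  · intro σ _ σ' _ hne
    rw [Function.onFun, Set.disjoint_left]
    rintro _ ⟨L, ⟨_, h1, _⟩, rfl⟩ ⟨L', ⟨_, h1', _⟩, e⟩
    have e := List.tail_eq_of_cons_eq e
    subst e
    rw [h1] at h1'
    exact hne (by simpa using h1')
  · exact (finite_below ρ).subset (fun σ hσ => hσ.1)
  · intro σ _
    exact (chainSet_finite _ _).image _

open Classical in
lemma H'_rec {μ ρ : YoungDiagram} (h : μ ≠ ρ) :
    H' n a μ ρ = (aNorm n a μ - aNorm n a ρ)⁻¹ *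
      ∑ σ ∈ (below ρ).filter (fun σ => Covers σ ρ), H' n a μ σ := by
  conv_lhs => rw [H', chainSet_concat h]
  rw [finsum_mem_biUnion, finset_setOf, finsum_mem_coe_finset, Finset.mul_sum]
  · apply Finset.sum_congr rfl
    intro σ _
    rw [finsum_mem_image (fun L _ L' _ h => List.append_cancel_right h), H', mul_finsum_mem]
    apply finsum_mem_congr rfl
    rintro L ⟨_, h2, _⟩
    cases L with
    | nil => simp at h2
    | cons τ L => simp [mul_comm]
  · intro σ _ σ' _ hne
    rw [Function.onFun, Set.disjoint_left]
    rintro _ ⟨L, ⟨_, _, h1⟩, rfl⟩ ⟨L', ⟨_, _, h1'⟩, e⟩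
    have e := List.append_cancel_right e
    subst e
    rw [h1] at h1'
    exact hne (by simpa using h1')
  · exact (finite_below ρ).subset (fun σ hσ => hσ.1)
  · intro σ _
    exact (chainSet_finite _ _).image _

lemma Covers.not_le {μ ν : YoungDiagram} (h : Covers μ ν) : ¬ ν ≤ μ := by
  intro h'
  have := Finset.card_le_card (YoungDiagram.cells_subset_iff.2 h')
  have h2 := h.2
  unfold YoungDiagram.card at h2
  omega

variable (hinj : ∀ ρ σ : YoungDiagram, ρ.colLen 0 ≤ n → σ.colLen 0 ≤ n →
  aNorm n a ρ = aNorm n a σ → ρ = σ)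

include hinj

open Classical in
lemma H_eig {μ ρ : YoungDiagram} (hμ : μ.colLen 0 ≤ n) (hρ : ρ.colLen 0 ≤ n) :
    (aNorm n a ρ - aNorm n a μ) * H n a μ ρ =
      ∑ σ ∈ below ρ, if Covers μ σ then H n a σ ρ else 0 := by
  rw [← Finset.sum_filter]
  by_cases h : μ = ρ
  · subst h
    rw [sub_self, zero_mul, Finset.sum_eq_zero]
    intro σ hσ
    simp only [Finset.mem_filter, mem_below] at hσ
    exact absurd hσ.1 hσ.2.not_le
  · rw [H_rec n a h, mul_inv_cancel_left₀]
    intro h0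
    exact h (hinj _ _ hρ hμ (sub_eq_zero.1 h0)).symm

open Classical in
lemma H'_eig {μ ρ τ : YoungDiagram} (hμ : μ.colLen 0 ≤ n) (hρ : ρ.colLen 0 ≤ n) (hτ : ρ ≤ τ) :
    (aNorm n a μ - aNorm n a ρ) * H' n a μ ρ =
      ∑ σ ∈ below τ, if Covers σ ρ then H' n a μ σ else 0 := by
  rw [← Finset.sum_filter]
  by_cases h : μ = ρ
  · subst h
    rw [sub_self, zero_mul, Finset.sum_eq_zero]
    intro σ hσ
    simp only [Finset.mem_filter, mem_below] at hσ
    exact H'_zero n a hσ.2.not_le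
  · rw [H'_rec n a h, mul_inv_cancel_left₀]
    · apply Finset.sum_congr _ (fun _ _ => rfl)
      ext σ
      simp only [Finset.mem_filter, mem_below]
      constructor
      · rintro ⟨h1, h2⟩; exact ⟨h1.trans hτ, h2⟩
      · rintro ⟨h1, h2⟩; exact ⟨h2.1, h2⟩
    · intro h0
      exact h (hinj _ _ hμ hρ (sub_eq_zero.1 h0))

open Classical in
lemma H_orth {ρ τ : YoungDiagram} (hρ : ρ.colLen 0 ≤ n) (hτ : τ.colLen 0 ≤ n) :
    ∑ ν ∈ below τ, H' n a ρ ν * H n a ν τ = if ρ = τ then 1 else 0 := by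
  split_ifs with h
  · subst h
    rw [Finset.sum_eq_single ρ, H_self, H'_self, one_mul]
    · intro ν hν hne
      rw [mem_below] at hν
      rw [H'_zero, zero_mul]
      intro h'
      exact hne (le_antisymm hν h')
    · intro h'
      exact absurd (mem_below.2 le_rfl) h'
  · have hne : aNorm n a ρ - aNorm n a τ ≠ 0 := fun h0 => h (hinj _ _ hρ hτ (sub_eq_zero.1 h0))
    apply (mul_eq_zero.1 _).resolve_left hne
    have e1 : ∑ ν ∈ below τ, ((aNorm n a ρ - aNorm n a ν) * H' n a ρ ν) * H n a ν τ =
        ∑ ν ∈ below τ, ∑ σ ∈ below τ, if Covers σ ν then H' n a ρ σ * H n a ν τ else 0 := by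
      apply Finset.sum_congr rfl
      intro ν hν
      rw [mem_below] at hν
      rw [H'_eig n a hinj hρ ((colLen_mono hν).trans hτ) hν, Finset.sum_mul]
      apply Finset.sum_congr rfl
      intro σ _
      rw [ite_mul, zero_mul]
    have e2 : ∑ ν ∈ below τ, H' n a ρ ν * ((aNorm n a τ - aNorm n a ν) * H n a ν τ) =
        ∑ ν ∈ below τ, ∑ σ ∈ below τ, if Covers ν σ then H' n a ρ ν * H n a σ τ else 0 := by
      apply Finset.sum_congr rfl
      intro ν hν
      rw [mem_below] at hν
      rw [H_eig n a hinj ((colLen_mono hν).trans hτ) hτ, Finset.mul_sum]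
      apply Finset.sum_congr rfl
      intro σ _
      rw [mul_ite, mul_zero]
    rw [Finset.sum_comm, ← e2] at e1
    rw [Finset.mul_sum, ← sub_eq_zero.2 e1, ← Finset.sum_sub_distrib]
    apply Finset.sum_congr rfl
    intro ν _
    ring

lemma sgen_H {μ ρ : YoungDiagram} (hμ : μ.colLen 0 ≤ n) (hρ : ρ.colLen 0 ≤ n) :
    sgen n μ.cells (subA n a ρ) a = H n a μ ρ * sgen n ρ.cells (subA n a ρ) a := by
  classical
  by_cases hle : μ ≤ ρ
  swap
  · rw [H_zero n a hle, zero_mul, sgen_vanish a μ ρ hμ hle]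
  induction hk : ρ.card - μ.card using Nat.strong_induction_on generalizing μ with
  | _ k ih =>
  by_cases h : μ = ρ
  · subst h; rw [H_self, one_mul]
  · have hne : aNorm n a ρ - aNorm n a μ ≠ 0 :=
      fun h0 => h (hinj _ _ hρ hμ (sub_eq_zero.1 h0)).symm
    apply mul_left_cancel₀ hne
    rw [pieri_diag a μ ρ hμ hρ, ← mul_assoc, H_eig n a hinj hμ hρ, ← Finset.sum_filter,
      Finset.sum_mul]
    apply Finset.sum_congr rfl
    intro σ hσ
    simp only [Finset.mem_filter, mem_below] at hσ
    have hcard : σ.card ≤ ρ.card := Finset.card_le_card (YoungDiagram.cells_subset_iff.2 hσ.1)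
    have := hσ.2.2
    exact ih (ρ.card - σ.card) (by omega) ((colLen_mono hσ.1).trans hρ) hσ.1 rfl

end

lemma idx_anti (n : ℕ) (ρ : YoungDiagram) :
    StrictAnti (fun i : Fin n => (ρ.rowLen i : ℤ) + (n : ℤ) - (i : ℤ)) := by
  intro i j h
  have h1 := ρ.rowLen_anti i j h.le
  have h2 : i.val < j.val := h
  simp only
  omega

lemma aNorm_inj (n : ℕ) (ρ σ : YoungDiagram) (hρ : ρ.colLen 0 ≤ n) (hσ : σ.colLen 0 ≤ n)
    (h : aNorm n aK ρ = aNorm n aK σ) : ρ = σ := by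
  have key : ∀ ρ σ : YoungDiagram, aNorm n aK ρ = aNorm n aK σ → ∀ i : Fin n, ∃ j : Fin n,
      (σ.rowLen j : ℤ) + (n : ℤ) - (j : ℤ) = (ρ.rowLen i : ℤ) + (n : ℤ) - (i : ℤ) := by
    intro ρ σ h i
    unfold aNorm subA aK at h
    rw [← map_sum, ← map_sum] at h
    have h := IsFractionRing.injective (MvPolynomial ℤ ℚ) Kfield h
    have h := congrArg (MvPolynomial.eval (fun k => if k = (ρ.rowLen i : ℤ) + (n : ℤ) - (i : ℤ)
      then (1 : ℚ) else 0)) h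
    simp only [map_sum, MvPolynomial.eval_X] at h
    by_contra hno
    push Not at hno
    rw [Finset.sum_eq_zero (s := Finset.univ) (f := fun j : Fin n =>
      if (σ.rowLen j : ℤ) + (n : ℤ) - (j : ℤ) = (ρ.rowLen i : ℤ) + (n : ℤ) - (i : ℤ)
      then (1 : ℚ) else 0) (fun j _ => if_neg (hno j))] at h
    have h2 := (Finset.sum_eq_zero_iff_of_nonneg (fun j _ => by split_ifs <;> norm_num)).1 h i
      (Finset.mem_univ i)
    simp at h2
  have hr : (fun i : Fin n => (ρ.rowLen i : ℤ) + (n : ℤ) - (i : ℤ)) =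
      (fun i : Fin n => (σ.rowLen i : ℤ) + (n : ℤ) - (i : ℤ)) := by
    rw [← (idx_anti n ρ).range_inj (idx_anti n σ)]
    apply le_antisymm
    · rintro _ ⟨i, rfl⟩
      obtain ⟨j, hj⟩ := key ρ σ h i
      exact ⟨j, hj⟩
    · rintro _ ⟨i, rfl⟩
      obtain ⟨j, hj⟩ := key σ ρ h.symm i
      exact ⟨j, hj⟩
  apply rl_inj hρ hσ
  funext i
  have := congrFun hr i
  unfold rl
  omega

lemma finite_N (n d : ℕ) (mu : YoungDiagram) :
    {nu : YoungDiagram | mu ≤ nu ∧ nu.colLen 0 ≤ n ∧ nu.card ≤ d}.Finite := by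
  apply Set.Finite.of_finite_image (f := rl n)
  · apply (Finset.finite_toSet (Finset.Iic (fun _ : Fin n => d))).subset
    rintro _ ⟨ν, ⟨_, h2, h3⟩, rfl⟩
    simp only [Finset.coe_Iic, Set.mem_Iic]
    intro i
    rw [card_eq_rl h2] at h3
    exact (Finset.single_le_sum (fun j _ => Nat.zero_le (rl n ν j)) (Finset.mem_univ i)).trans h3
  · intro ν hν ν' hν' h
    exact rl_inj hν.2.1 hν'.2.1 h

noncomputable abbrev Rb : Type := MvPolynomial ℤ Kfield

noncomputable def aR : ℤ → Rb := fun k => MvPolynomial.C (aK k)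

lemma aK_inj : Function.Injective aK := by
  intro i j h
  exact MvPolynomial.X_injective (IsFractionRing.injective (MvPolynomial ℤ ℚ) Kfield h)

lemma aR_inj : Function.Injective aR := by
  intro i j h
  exact aK_inj (MvPolynomial.C_injective _ _ h)

lemma sgen_aR (n : ℕ) (ν τ : YoungDiagram) (hν : ν.colLen 0 ≤ n) (hτ : τ.colLen 0 ≤ n) :
    sgen n ν.cells (subA n aR τ) aR =
      MvPolynomial.C (H n aK ν τ * sgen n τ.cells (subA n aK τ) aK) := by
  rw [← sgen_H n aK (aNorm_inj n) hν hτ, sgen_map]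
  rfl

/-- the coefficient, as an element of the ring of polynomials in the `b` variables -/
noncomputable def cf (n : ℕ) (P : YoungDiagram → Rb) (mu nu : YoungDiagram) : Rb :=
  ∑ rho ∈ below nu, P rho * MvPolynomial.C (H n aK mu rho * H' n aK rho nu)

lemma vanish_pt (n : ℕ) (P : YoungDiagram → Rb) (mu τ : YoungDiagram)
    (hmu : mu.colLen 0 ≤ n) (hτ : τ.colLen 0 ≤ n) (N : Finset YoungDiagram)
    (hN : ∀ ν ∈ N, ν.colLen 0 ≤ n) (hN' : ∀ ν, mu ≤ ν → ν ≤ τ → ν ∈ N) :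
    P τ * sgen n mu.cells (subA n aR τ) aR =
      ∑ nu ∈ N, cf n P mu nu * sgen n nu.cells (subA n aR τ) aR := by
  classical
  have s1 : ∑ nu ∈ N, cf n P mu nu * sgen n nu.cells (subA n aR τ) aR =
      ∑ nu ∈ below τ, cf n P mu nu * sgen n nu.cells (subA n aR τ) aR := by
    refine (Finset.sum_subset_zero_on_sdiff (s₁ := N ∩ below τ) Finset.inter_subset_left ?_
      (fun _ _ => rfl)).symm.trans
      (Finset.sum_subset_zero_on_sdiff Finset.inter_subset_right ?_ (fun _ _ => rfl))
    · intro ν hν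
      simp only [Finset.mem_sdiff, Finset.mem_inter, mem_below, not_and] at hν
      rw [sgen_vanish _ _ _ (hN ν hν.1) (hν.2 hν.1), mul_zero]
    · intro ν hν
      simp only [Finset.mem_sdiff, Finset.mem_inter, mem_below, not_and] at hν
      have : ¬ mu ≤ ν := fun h => hν.2 (hN' ν h hν.1) hν.1
      rw [cf, Finset.sum_eq_zero, zero_mul]
      intro ρ hρ
      rw [mem_below] at hρ
      rw [H_zero n aK (fun h => this (h.trans hρ)), zero_mul, map_zero, mul_zero]
  rw [s1, sgen_aR n _ _ hmu hτ]
  have s2 : ∀ ν ∈ below τ, cf n P mu ν * sgen n ν.cells (subA n aR τ) aR =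
      ∑ ρ ∈ below τ, P ρ * MvPolynomial.C (H n aK mu ρ * sgen n τ.cells (subA n aK τ) aK) *
        MvPolynomial.C (H' n aK ρ ν * H n aK ν τ) := by
    intro ν hν
    rw [mem_below] at hν
    rw [sgen_aR n _ _ ((colLen_mono hν).trans hτ) hτ, cf, Finset.sum_mul]
    rw [Finset.sum_subset (s₁ := below ν) (s₂ := below τ)]
    · apply Finset.sum_congr rfl
      intro ρ _
      simp only [map_mul]
      ring
    · intro ρ hρ
      rw [mem_below] at hρ ⊢
      exact hρ.trans hν
    · intro ρ _ hρ
      rw [mem_below] at hρ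
      rw [H'_zero n aK hρ, mul_zero, map_zero, mul_zero, zero_mul]
  rw [Finset.sum_congr rfl s2, Finset.sum_comm]
  have s3 : ∀ ρ ∈ below τ, (∑ ν ∈ below τ, P ρ *
      MvPolynomial.C (H n aK mu ρ * sgen n τ.cells (subA n aK τ) aK) *
        MvPolynomial.C (H' n aK ρ ν * H n aK ν τ)) =
      if ρ = τ then P ρ * MvPolynomial.C (H n aK mu ρ * sgen n τ.cells (subA n aK τ) aK)
        else 0 := by
    intro ρ hρ
    rw [mem_below] at hρ
    rw [← Finset.mul_sum, ← map_sum, H_orth n aK (aNorm_inj n) ((colLen_mono hρ).trans hτ) hτ]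
    split_ifs <;> simp
  rw [Finset.sum_congr rfl s3, Finset.sum_ite_eq' (below τ) τ, if_pos (mem_below.2 le_rfl)]

section
variable {k : Type} [CommRing k]

noncomputable def Phi (n : ℕ) :
    MvPolynomial (ℤ ⊕ Fin n) k →+* MvPolynomial (Fin n) (MvPolynomial ℤ k) :=
  ((MvPolynomial.sumRingEquiv k (Fin n) ℤ) : _ →+* _).comp
    (MvPolynomial.rename (Sum.swap : ℤ ⊕ Fin n → Fin n ⊕ ℤ) : _ →ₐ[k] _).toRingHom

lemma Phi_inj (n : ℕ) : Function.Injective (Phi (k := k) n) := by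
  intro p q h
  have h := (MvPolynomial.sumRingEquiv k (Fin n) ℤ).injective h
  exact MvPolynomial.rename_injective _ Sum.swap_leftInverse.injective h

lemma Phi_inr (n : ℕ) (i : Fin n) :
    Phi (k := k) n (MvPolynomial.X (Sum.inr i)) = MvPolynomial.X i := by
  simp [Phi]

lemma Phi_inl (n : ℕ) (j : ℤ) :
    Phi (k := k) n (MvPolynomial.X (Sum.inl j)) = MvPolynomial.C (MvPolynomial.X j) := by
  simp [Phi]

lemma Phi_C (n : ℕ) (c : k) :
    Phi n (MvPolynomial.C c) = MvPolynomial.C (MvPolynomial.C c) := by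
  simp [Phi]

lemma Phi_sgen (n : ℕ) (s : Finset (ℕ × ℕ)) (x : Fin n → MvPolynomial (ℤ ⊕ Fin n) k)
    (a : ℤ → MvPolynomial (ℤ ⊕ Fin n) k) :
    Phi n (sgen n s x a) = sgen n s (fun i => Phi n (x i)) (fun j => Phi n (a j)) :=
  sgen_map (Phi n) n s x a

lemma eval_sgen {n : ℕ} (y : Fin n → k) (s : Finset (ℕ × ℕ)) (b : ℤ → k) : MvPolynomial.eval y
      (sgen n s (fun i => (MvPolynomial.X i : MvPolynomial (Fin n) k))
        (fun j => MvPolynomial.C (b j))) = sgen n s y b := by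
  rw [sgen_map (MvPolynomial.eval y)]
  simp only [MvPolynomial.eval_X, MvPolynomial.eval_C]

lemma C_sgen {n : ℕ} (x : Fin n → k) (s : Finset (ℕ × ℕ)) (b : ℤ → k) :
    (MvPolynomial.C (sgen n s x b) : MvPolynomial (Fin n) k) =
      sgen n s (fun i => MvPolynomial.C (x i)) (fun j => MvPolynomial.C (b j)) :=
  sgen_map (MvPolynomial.C) n s x b

end

lemma main_poly (n : ℕ) (θi θo : YoungDiagram) (hθ : θi ≤ θo)
    (mu : YoungDiagram) (hmu : mu.colLen 0 ≤ n) :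
    sgen n (skewCells θi θo) (fun i => (MvPolynomial.X i : MvPolynomial (Fin n) Rb))
        (fun k => MvPolynomial.C (MvPolynomial.X k)) *
      sgen n mu.cells (fun i => MvPolynomial.X i) (fun k => MvPolynomial.C (aR k)) =
    ∑ nu ∈ (finite_N n ((skewCells θi θo).card + mu.card) mu).toFinset,
      MvPolynomial.C (cf n (fun rho => sgen n (skewCells θi θo) (subA n aR rho)
          (fun k => MvPolynomial.X k)) mu nu) *
        sgen n nu.cells (fun i => MvPolynomial.X i) (fun k => MvPolynomial.C (aR k)) := by
  set N := (finite_N n ((skewCells θi θo).card + mu.card) mu).toFinset with hNdef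
  have hN : ∀ ν, ν ∈ N ↔ (mu ≤ ν ∧ ν.colLen 0 ≤ n ∧
      ν.card ≤ (skewCells θi θo).card + mu.card) := by
    intro ν; simp [hNdef]
  set P : YoungDiagram → Rb := fun rho => sgen n (skewCells θi θo) (subA n aR rho)
          (fun k => MvPolynomial.X k) with hP
  have ev : ∀ (y : Fin n → Rb) (s : Finset (ℕ × ℕ)) (b : ℤ → Rb), MvPolynomial.eval y
      (sgen n s (fun i => (MvPolynomial.X i : MvPolynomial (Fin n) Rb))
        (fun k => MvPolynomial.C (b k))) = sgen n s y b := by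
    intro y s b
    exact eval_sgen y s b
  rw [← sub_eq_zero]
  have evf : ∀ y : Fin n → Rb, MvPolynomial.eval y
      (sgen n (skewCells θi θo) (fun i => (MvPolynomial.X i : MvPolynomial (Fin n) Rb))
        (fun k => MvPolynomial.C (MvPolynomial.X k)) *
      sgen n mu.cells (fun i => MvPolynomial.X i) (fun k => MvPolynomial.C (aR k)) -
      ∑ nu ∈ N, MvPolynomial.C (cf n P mu nu) *
        sgen n nu.cells (fun i => MvPolynomial.X i) (fun k => MvPolynomial.C (aR k))) =
      sgen n (skewCells θi θo) y (fun k => MvPolynomial.X k) * sgen n mu.cells y aR -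
        ∑ nu ∈ N, cf n P mu nu * sgen n nu.cells y aR := by
    intro y
    rw [map_sub, map_mul, ev, ev, map_sum]
    congr 1
    apply Finset.sum_congr rfl
    intro ν _
    rw [map_mul, ev, MvPolynomial.eval_C]
  have sym : ∀ (σ : Equiv.Perm (Fin n)) (y : Fin n → Rb),
      sgen n (skewCells θi θo) (y ∘ σ) (fun k => MvPolynomial.X k) * sgen n mu.cells (y ∘ σ) aR -
        ∑ nu ∈ N, cf n P mu nu * sgen n nu.cells (y ∘ σ) aR =
      sgen n (skewCells θi θo) y (fun k => MvPolynomial.X k) * sgen n mu.cells y aR -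
        ∑ nu ∈ N, cf n P mu nu * sgen n nu.cells y aR := by
    intro σ y
    rw [sgen_skew_symm _ _ _ _ hθ, sgen_straight_symm _ _ _ hmu]
    congr 1
    apply Finset.sum_congr rfl
    intro ν hν
    rw [sgen_straight_symm _ _ _ ((hN ν).1 hν).2.1]
  apply uniq_sym n ((skewCells θi θo).card + mu.card) (fun k => aR ((k : ℤ) + 1))
  · intro i j h
    have := aR_inj h
    omega
  · refine (MvPolynomial.totalDegree_sub _ _).trans (max_le ?_ ?_)
    · exact (MvPolynomial.totalDegree_mul _ _).trans
        (Nat.add_le_add (sgen_deg n _ _) (sgen_deg n _ _))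
    · apply MvPolynomial.totalDegree_finsetSum_le
      intro ν hν
      refine (MvPolynomial.totalDegree_mul _ _).trans ?_
      rw [MvPolynomial.totalDegree_C, zero_add]
      exact (sgen_deg n _ _).trans ((hN ν).1 hν).2.2
  · intro σ y
    rw [evf, evf, sym]
  · intro ρ hρ hsum
    have hanti : Antitone (ρ ∘ Fin.rev) := fun i j h => hρ (Fin.rev_le_rev.2 h)
    have hcol := colLen_mkYD (ρ ∘ Fin.rev) hanti
    have hcard : (mkYD (ρ ∘ Fin.rev) hanti).card = ∑ i, ρ i := by
      rw [card_eq_rl hcol, rl_mkYD]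
      exact Equiv.sum_comp Fin.revPerm ρ
    have hrl := rl_mkYD (ρ ∘ Fin.rev) hanti
    set τ := mkYD (ρ ∘ Fin.rev) hanti
    have hpt : (fun i : Fin n => (fun k : ℕ => aR ((k : ℤ) + 1)) (ρ i + i.val)) =
        subA n aR τ ∘ (Fin.revPerm : Equiv.Perm (Fin n)) := by
      funext i
      have h1 := congrFun hrl i.rev
      simp only [rl, Function.comp, Fin.rev_rev] at h1
      simp only [subA, Function.comp, Fin.revPerm_apply, h1]
      have := i.isLt
      rw [Fin.val_rev]
      congr 1
      omega
    rw [hpt, evf, sym, sub_eq_zero]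
    refine vanish_pt n P mu τ hmu hcol N (fun ν hν => ((hN ν).1 hν).2.1) ?_
    intro ν h1 h2
    rw [hN]
    refine ⟨h1, (colLen_mono h2).trans hcol, ?_⟩
    have : ν.card ≤ τ.card := Finset.card_le_card (YoungDiagram.cells_subset_iff.2 h2)
    omega

/-- In `ℚ(a_i)[b_i : i ∈ ℤ][x_1,…,x_n]`,
`s_θ(x|b)·s_μ(x|a) = Σ_ν c^ν_{θμ}(a,b)·s_ν(x|a)` with
`c^ν_{θμ}(a,b) = Σ_{μ ⊆ ρ ⊆ ν} s_θ(a_ρ|b)·H(μ,ρ)·H'(ρ,ν)`. -/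
theorem factorial_LR_via_H (n : ℕ) (hn : 1 ≤ n) (θi θo : YoungDiagram) (hθ : θi ≤ θo)
    (mu : YoungDiagram) (hmu : mu.colLen 0 ≤ n) :
    sgen n (skewCells θi θo)
        (fun i => (MvPolynomial.X (Sum.inr i) : MvPolynomial (ℤ ⊕ Fin n) Kfield))
        (fun k => MvPolynomial.X (Sum.inl k)) *
      sgen n mu.cells (fun i => MvPolynomial.X (Sum.inr i))
        (fun k => MvPolynomial.C (aK k)) =
    ∑ᶠ nu ∈ {nu : YoungDiagram | mu ≤ nu ∧ nu.colLen 0 ≤ n ∧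
        nu.card ≤ (skewCells θi θo).card + mu.card},
      (∑ᶠ rho ∈ {rho : YoungDiagram | mu ≤ rho ∧ rho ≤ nu},
        sgen n (skewCells θi θo)
            (subA n (fun k => (MvPolynomial.C (aK k) : MvPolynomial (ℤ ⊕ Fin n) Kfield)) rho)
            (fun k => MvPolynomial.X (Sum.inl k)) *
          MvPolynomial.C (H n aK mu rho * H' n aK rho nu)) *
        sgen n nu.cells (fun i => MvPolynomial.X (Sum.inr i))
          (fun k => MvPolynomial.C (aK k)) := by
  classical
  rw [← finite_N n ((skewCells θi θo).card + mu.card) mu |>.coe_toFinset, finsum_mem_coe_finset]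
  apply Phi_inj n
  rw [map_mul, map_sum, Phi_sgen, Phi_sgen]
  simp only [Phi_inr, Phi_inl, Phi_C]
  refine (main_poly n θi θo hθ mu hmu).trans ?_
  apply Finset.sum_congr rfl
  intro nu _
  rw [map_mul, Phi_sgen n nu.cells]
  simp only [Phi_inr, Phi_C]
  refine congrArg₂ (· * ·) ?_ rfl
  have hset : {rho : YoungDiagram | mu ≤ rho ∧ rho ≤ nu} =
      (((below nu).filter (fun rho => mu ≤ rho) : Finset YoungDiagram) : Set YoungDiagram) := by
    ext σ; simp [mem_below, and_comm]
  rw [hset, finsum_mem_coe_finset, map_sum, cf, map_sum, Finset.sum_filter]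
  apply Finset.sum_congr rfl
  intro rho _
  split_ifs with h
  · rw [map_mul (MvPolynomial.C), map_mul (Phi n), Phi_sgen, Phi_C, C_sgen]
    refine congrArg₂ (· * ·) ?_ rfl
    simp only [subA, Phi_C, Phi_inl]
    rfl
  · rw [H_zero n aK h, zero_mul, map_zero, mul_zero, map_zero]

end FactorialLR
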